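/- arXiv:0905.2576 — 2 statements merged into one kernel-verified Lean document; each statement's English description precedes it below -/
import Mathlib

section
/- Let X be a continuum without cut points. Then X has at most countably many inseparable cut pairs and at most countably many necklaces. -/
open Set

section Defs

variable {X : Type*} [TopologicalSpace X]

/-- `U` is relatively open in the subspace `X - C`. -/
def RelOpen (C U : Set X) : Prop := ∃ O : Set X, IsOpen O ∧ U = O ∩ Cᶜ

/-- `U, V` form a disconnection of `X - C` into two nonempty relatively open sets. -/
def SepPair (C U V : Set X) : Prop :=
  RelOpen C U ∧ RelOpen C V ∧ Disjoint U V ∧ U ∪ V = Cᶜ ∧ U.Nonempty ∧ V.Nonempty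

/-- `C` separates `A` from `B`. -/
def Separates (C A B : Set X) : Prop := ∃ U V : Set X, SepPair C U V ∧ A ⊆ U ∧ B ⊆ V

/-- `C` separates `X`, i.e. `X - C` is disconnected. -/
def Cuts (C : Set X) : Prop := ∃ U V : Set X, SepPair C U V

def CutPoint (c : X) : Prop := Cuts ({c} : Set X)

def CutPair (c d : X) : Prop := c ≠ d ∧ ¬CutPoint c ∧ ¬CutPoint d ∧ Cuts ({c, d} : Set X)

def IsSubcontinuum (Y : Set X) : Prop := IsCompact Y ∧ IsConnected Y

/-- A nondegenerate set no two of whose points are separated by a cut pair. -/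
def InsepSet (A : Set X) : Prop :=
  A.Nontrivial ∧ ∀ c d : X, CutPair c d → ∀ a ∈ A, ∀ b ∈ A,
    ¬Separates ({c, d} : Set X) {a} {b}

def MaxInsep (A : Set X) : Prop := InsepSet A ∧ ∀ B : Set X, InsepSet B → A ⊆ B → B = A

def InsepCutPair (a b : X) : Prop := CutPair a b ∧ InsepSet ({a, b} : Set X)

/-- A cyclic decomposition of `X` by the points `x 0, …, x (n-1)` (cyclically indexed),
into subcontinua `M i`, consecutive ones meeting in a single point. -/
def CyclicDecomp (n : ℕ) (x : ZMod n → X) (M : ZMod n → Set X) : Prop :=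
  2 < n ∧ Function.Injective x ∧
  (∀ i, IsSubcontinuum (M i)) ∧
  (∀ i, M i ∩ M (i + 1) = {x (i + 1)}) ∧
  (∀ i j, i ≠ j → j ≠ i + 1 → i ≠ j + 1 → M i ∩ M j = ∅) ∧
  (⋃ i, M i) = univ

/-- A finite set is cyclic if it is a cut pair, or admits a cyclic decomposition. -/
def CyclicFinset (S : Set X) : Prop :=
  (∃ a b : X, CutPair a b ∧ S = {a, b}) ∨
  (∃ n : ℕ, ∃ (x : ZMod n → X) (M : ZMod n → Set X), CyclicDecomp n x M ∧ S = Set.range x)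

/-- A set (with more than one point) is cyclic if every finite subset with more
than one element is cyclic. -/
def CyclicSet (S : Set X) : Prop :=
  ∀ A : Finset X, ↑A ⊆ S → 1 < A.card → CyclicFinset (↑A : Set X)

/-- A necklace: a maximal cyclic subset with more than two elements. -/
def Necklace (S : Set X) : Prop :=
  CyclicSet S ∧ (∃ a ∈ S, ∃ b ∈ S, ∃ c ∈ S, a ≠ b ∧ a ≠ c ∧ b ≠ c) ∧
  ∀ S' : Set X, CyclicSet S' → S ⊆ S' → S' = S

/-- Membership in the collection `R`: necklaces, maximal inseparable sets,
and inseparable cut pairs. -/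
def InR (S : Set X) : Prop :=
  Necklace S ∨ MaxInsep S ∨ ∃ a b : X, InsepCutPair a b ∧ S = {a, b}

/-- `A` has exactly two connected components. -/
def TwoComponents (A : Set X) : Prop :=
  ∃ u ∈ A, ∃ v ∈ A, connectedComponentIn A u ≠ connectedComponentIn A v ∧
    ∀ w ∈ A, connectedComponentIn A w = connectedComponentIn A u ∨
      connectedComponentIn A w = connectedComponentIn A v

/-- `S`-equivalence of points of `X - S`: they lie in the same piece of every
cyclic decomposition of `X` by a finite subset of `S`. -/
def SEquiv (S : Set X) (y z : X) : Prop :=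
  y ∉ S ∧ z ∉ S ∧
  ∀ (n : ℕ) (x : ZMod n → X) (M : ZMod n → Set X),
    CyclicDecomp n x M → Set.range x ⊆ S → ∃ i, y ∈ M i ∧ z ∈ M i

end Defs


section CutPairs

variable {X : Type*} [TopologicalSpace X]

/-- `X` is the union of the closed sets `Z` and `Z'`, both proper, which meet exactly in `a, b`. -/
structure Split (a b : X) (Z Z' : Set X) : Prop where
  isClosed_left : IsClosed Z
  isClosed_right : IsClosed Z'
  cover : ∀ z, z ∈ Z ∨ z ∈ Z'
  inter : ∀ z, z ∈ Z → z ∈ Z' → z = a ∨ z = b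
  fst_left : a ∈ Z
  fst_right : a ∈ Z'
  snd_left : b ∈ Z
  snd_right : b ∈ Z'
  exists_left : ∃ z ∈ Z, z ∉ Z'
  exists_right : ∃ z ∈ Z', z ∉ Z

theorem Split.symm {a b : X} {Z Z' : Set X} (h : Split a b Z Z') : Split a b Z' Z :=
  ⟨h.2, h.1, fun z => (h.3 z).symm, fun z h1 h2 => h.4 z h2 h1, h.6, h.5, h.8, h.7, h.10, h.9⟩

theorem Split.swap {a b : X} {Z Z' : Set X} (h : Split a b Z Z') : Split b a Z Z' :=
  ⟨h.1, h.2, h.3, fun z h1 h2 => (h.4 z h1 h2).symm, h.7, h.8, h.5, h.6, h.9, h.10⟩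

theorem sepPair_of_closed_cover {C K K' : Set X} (hK : IsClosed K) (hK' : IsClosed K')
    (hcov : ∀ z, z ∈ K ∨ z ∈ K') (hmeet : ∀ z, z ∈ K → z ∈ K' → z ∈ C)
    (h : ∃ z ∈ K, z ∉ C) (h' : ∃ z ∈ K', z ∉ C) : SepPair C (K \ C) (K' \ C) := by
  refine ⟨⟨K'ᶜ, hK'.isOpen_compl, ?_⟩, ⟨Kᶜ, hK.isOpen_compl, ?_⟩, ?_, ?_, ?_, ?_⟩
  · ext z; have := hcov z; have := hmeet z; simp only [mem_sdiff, mem_inter_iff, mem_compl_iff]; tauto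
  · ext z; have := hcov z; have := hmeet z; simp only [mem_sdiff, mem_inter_iff, mem_compl_iff]; tauto
  · rw [Set.disjoint_left]; rintro z ⟨h1, h2⟩ ⟨h3, _⟩; exact h2 (hmeet z h1 h3)
  · ext z; have := hcov z; simp only [mem_sdiff, mem_union, mem_compl_iff]; tauto
  · obtain ⟨z, h1, h2⟩ := h; exact ⟨z, h1, h2⟩
  · obtain ⟨z, h1, h2⟩ := h'; exact ⟨z, h1, h2⟩

theorem subset_singleton_or_of_closed_cover (hnc : ∀ p : X, ¬CutPoint p) (t : X) {K K' : Set X}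
    (hK : IsClosed K) (hK' : IsClosed K') (hcov : ∀ z, z ∈ K ∨ z ∈ K')
    (hmeet : ∀ z, z ∈ K → z ∈ K' → z = t) : (∀ z ∈ K, z = t) ∨ (∀ z ∈ K', z = t) := by
  by_contra! hcon
  exact hnc t ⟨_, _, sepPair_of_closed_cover hK hK' hcov hmeet hcon.1 hcon.2⟩

theorem CutPair.symm {a b : X} (h : CutPair a b) : CutPair b a :=
  ⟨h.1.symm, h.2.2.1, h.2.1, by rw [Set.pair_comm]; exact h.2.2.2⟩

theorem CutPair.exists_split [T1Space X] {a b : X} (h : CutPair a b) :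
    ∃ Z Z', Split a b Z Z' := by
  obtain ⟨-, -, -, U, V, ⟨O, hO, rfl⟩, ⟨O', hO', rfl⟩, hd, hu, ⟨u, hu1⟩, ⟨v, hv1⟩⟩ := h
  have hC : IsOpen ({a, b} : Set X)ᶜ := (Set.toFinite {a, b}).isClosed.isOpen_compl
  have hd' := Set.disjoint_left.1 hd
  have key : ∀ z, (z ∈ O ∩ {a, b}ᶜ ∨ z ∈ O' ∩ {a, b}ᶜ) ↔ ¬ (z = a ∨ z = b) := fun z => by
    have := Set.ext_iff.1 hu z
    simpa using this
  refine ⟨(O' ∩ {a, b}ᶜ)ᶜ, (O ∩ {a, b}ᶜ)ᶜ, (hO'.inter hC).isClosed_compl,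
    (hO.inter hC).isClosed_compl, ?_, ?_, ?_, ?_, ?_, ?_, ?_, ?_⟩
  · intro z
    by_contra! hz
    simp only [mem_compl_iff, not_not] at hz
    exact hd' hz.2 hz.1
  · intro z h1 h2
    by_contra hz
    rcases (key z).2 hz with h | h
    · exact h2 h
    · exact h1 h
  all_goals first | simp; done | skip
  · exact ⟨u, fun h => hd' hu1 h, fun h => h hu1⟩
  · exact ⟨v, fun h => hd' h hv1, fun h => h hv1⟩

theorem Split.cutPair (hnc : ∀ p : X, ¬CutPoint p) {a b : X} {Z Z' : Set X} (h : Split a b Z Z')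
    (hab : a ≠ b) : CutPair a b := by
  obtain ⟨z, hz, hz'⟩ := h.exists_left
  obtain ⟨w, hw, hw'⟩ := h.exists_right
  refine ⟨hab, hnc a, hnc b, _, _, sepPair_of_closed_cover h.isClosed_left h.isClosed_right h.cover
    h.inter ⟨z, hz, ?_⟩ ⟨w, hw, ?_⟩⟩
  · rintro (rfl | rfl)
    · exact hz' h.fst_right
    · exact hz' h.snd_right
  · rintro (rfl | rfl)
    · exact hw' h.fst_left
    · exact hw' h.snd_left

theorem InsepSet.false_of_closed_cover (hnc : ∀ p : X, ¬CutPoint p) {u v c d : X}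
    (h : InsepSet ({u, v} : Set X)) {K K' : Set X} (hK : IsClosed K) (hK' : IsClosed K')
    (hcov : ∀ z, z ∈ K ∨ z ∈ K') (hmeet : ∀ z, z ∈ K → z ∈ K' → z = c ∨ z = d)
    (hu : u ∈ K) (huc : u ≠ c) (hud : u ≠ d) (hv : v ∈ K') (hvc : v ≠ c) (hvd : v ≠ d) : False := by
  by_cases hcd : c = d
  · subst hcd
    rcases subset_singleton_or_of_closed_cover hnc c hK hK' hcov (by simpa using hmeet) with h | h
    · exact huc (h _ hu)
    · exact hvc (h _ hv)
  · have hS := sepPair_of_closed_cover (C := {c, d}) hK hK' hcov hmeet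
      ⟨u, hu, by simp [huc, hud]⟩ ⟨v, hv, by simp [hvc, hvd]⟩
    refine h.2 c d ⟨hcd, hnc c, hnc d, _, _, hS⟩ u (by simp) v (by simp) ⟨_, _, hS, ?_, ?_⟩
    · simp [hu, huc, hud]
    · simp [hv, hvc, hvd]

end CutPairs

section Inseparable

variable {X : Type*} [TopologicalSpace X]

theorem Split.inter_subset_of_mem (hnc : ∀ p : X, ¬CutPoint p) {a b c d : X} {Z Z' W W' : Set X}
    (h : Split a b Z Z') (k : Split c d W W') (hab : a ≠ b) (hcd : c ≠ d)
    (hne : ({a, b} : Set X) ≠ {c, d}) (ha : a ∈ W) (hb : b ∈ W) (hc : c ∈ Z') (hd : d ∈ Z') :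
    ∀ z ∈ W', z ∈ Z → z = a ∨ z = b := by
  have key : ∃ t, (t = a ∨ t = b) ∧ ∀ z, z ∈ W' → z ∈ Z → z ∈ W ∨ z ∈ Z' → z = t := by
    by_cases hac : a = c ∨ a = d
    · refine ⟨a, Or.inl rfl, ?_⟩
      have hbc : ¬ (b = c ∨ b = d) := by
        intro hbc
        apply hne
        rcases hac with rfl | rfl <;> rcases hbc with rfl | rfl <;> simp_all [Set.pair_comm]
      intro z h1 h2 h3
      have := h.inter z h2
      have := k.inter z
      grind
    · refine ⟨b, Or.inr rfl, ?_⟩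
      intro z h1 h2 h3
      have := h.inter z h2
      have := k.inter z
      grind
  obtain ⟨t, ht, key⟩ := key
  rcases subset_singleton_or_of_closed_cover hnc t (K := W' ∩ Z) (K' := W ∪ Z')
    (k.isClosed_right.inter h.isClosed_left) (k.isClosed_left.union h.isClosed_right)
    (fun z => by have := h.cover z; have := k.cover z; simp; tauto)
    (fun z h1 h2 => key z h1.1 h1.2 h2) with h1 | h1
  · intro z hz hz'
    rw [h1 z ⟨hz, hz'⟩]
    exact ht
  · exact absurd ((h1 a (Or.inl ha)).trans (h1 b (Or.inl hb)).symm) hab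

theorem Split.mem_side_of_insepSet (hnc : ∀ p : X, ¬CutPoint p) {a b c d : X} {Z Z' : Set X}
    (h : Split a b Z Z') (hi : InsepSet ({c, d} : Set X)) :
    (c ∈ Z ∧ d ∈ Z) ∨ (c ∈ Z' ∧ d ∈ Z') := by
  have hc := h.cover c
  have hd := h.cover d
  have hi' : InsepSet ({d, c} : Set X) := by rwa [Set.pair_comm]
  by_contra! hcon
  have h1 := hi.false_of_closed_cover hnc h.isClosed_left h.isClosed_right h.cover h.inter
  have h2 := hi'.false_of_closed_cover hnc h.isClosed_left h.isClosed_right h.cover h.inter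
  have key : ∀ z, z = a ∨ z = b → z ∈ Z ∧ z ∈ Z' := by
    rintro z (rfl | rfl)
    · exact ⟨h.fst_left, h.fst_right⟩
    · exact ⟨h.snd_left, h.snd_right⟩
  have := key c
  have := key d
  grind

theorem Split.subset_or_subset (hnc : ∀ p : X, ¬CutPoint p) {a b c d x y : X} {Z Z' W W' : Set X}
    (h : Split a b Z Z') (k : Split c d W W') (hab : a ≠ b) (hcd : c ≠ d)
    (hne : ({a, b} : Set X) ≠ {c, d}) (hi : InsepSet ({a, b} : Set X))
    (ki : InsepSet ({c, d} : Set X)) (hx : x ∉ Z') (hx' : x ∉ W') (hy : y ∉ Z) (hy' : y ∉ W) :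
    (Z ⊆ W ∧ W' ⊆ Z') ∨ (W ⊆ Z ∧ Z' ⊆ W') := by
  have fr := h.fst_right
  have sr := h.snd_right
  have fl := h.fst_left
  have sl := h.snd_left
  have hcov := h.cover
  have kcov := k.cover
  rcases k.mem_side_of_insepSet hnc hi with ⟨ha, hb⟩ | ⟨ha, hb⟩ <;>
  rcases h.mem_side_of_insepSet hnc ki with ⟨hc, hd⟩ | ⟨hc, hd⟩
  · have := h.symm.inter_subset_of_mem hnc k hab hcd hne ha hb hc hd y
    grind
  · have := h.inter_subset_of_mem hnc k hab hcd hne ha hb hc hd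
    left
    constructor <;> intro z hz <;> grind
  · have := h.symm.inter_subset_of_mem hnc k.symm hab hcd hne ha hb hc hd
    right
    constructor <;> intro z hz <;> grind
  · have := h.inter_subset_of_mem hnc k.symm hab hcd hne ha hb hc hd x
    grind

/-- `A` and `B` are the two parts of the region between a pair `c, c'` and the pair `a, b`. -/
theorem Split.exists_mem_part (hnc : ∀ p : X, ¬CutPoint p) {a b c c' x : X}
    {Z Z' W W' A B : Set X} (h : Split a b Z Z') (k : Split c c' W W') (hWZ : W ⊆ Z)
    (hZW : Z' ⊆ W') (hx : x ∉ Z') (hxW : x ∈ W) (hA : IsClosed A) (hB : IsClosed B)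
    (hAB : ∀ z, z ∈ W' ∧ z ∈ Z ↔ z ∈ A ∨ z ∈ B) (hd : ∀ z ∈ A, z ∉ B) (ha : a ∈ A) (hb : b ∈ B) :
    c ∈ A ∨ c' ∈ A := by
  by_contra! hcon
  have fr := h.fst_right
  have sr := h.snd_right
  have hcov := h.cover
  have kcov := k.cover
  have hin := h.inter
  have kin := k.inter
  have hA1 : ∀ z ∈ A, z = a := by
    rcases subset_singleton_or_of_closed_cover hnc a (K := A) (K' := W ∪ (Z' ∪ B)) hA
      (k.isClosed_left.union (h.isClosed_right.union hB))
      (fun z => by simp only [mem_union]; grind)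
      (fun z h1 h2 => by simp only [mem_union] at h2; grind) with h1 | h1
    · exact h1
    · have := h1 b (by simp [sr]); grind
  rcases subset_singleton_or_of_closed_cover hnc b (K := W ∪ B) (K' := Z')
      (k.isClosed_left.union hB) h.isClosed_right
      (fun z => by simp only [mem_union]; grind)
      (fun z h1 h2 => by simp only [mem_union] at h1; grind) with h1 | h1
  · have := h1 x (by simp [hxW]); grind
  · have := h1 a fr; grind

/-- A family of pairwise different inseparable cut pairs `p`, each with a decomposition into closed
sides `Z p` and `Z' p` which separates the point `x` from the point `y`. -/
structure SepFamily (x y : X) (I : Set (X × X)) (Z Z' : X × X → Set X) : Prop where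
  insep : ∀ p ∈ I, InsepSet ({p.1, p.2} : Set X)
  ne : ∀ p ∈ I, p.1 ≠ p.2
  split : ∀ p ∈ I, Split p.1 p.2 (Z p) (Z' p)
  notMem_right : ∀ p ∈ I, x ∉ Z' p
  notMem_left : ∀ p ∈ I, y ∉ Z p
  pair_ne : ∀ p ∈ I, ∀ q ∈ I, p ≠ q → ({p.1, p.2} : Set X) ≠ {q.1, q.2}

theorem SepFamily.symm {x y : X} {I : Set (X × X)} {Z Z' : X × X → Set X}
    (h : SepFamily x y I Z Z') : SepFamily y x I Z' Z :=
  ⟨h.1, h.2, fun p hp => (h.3 p hp).symm, h.5, h.4, h.6⟩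

theorem SepFamily.subset_or_subset (hnc : ∀ p : X, ¬CutPoint p) {x y : X} {I : Set (X × X)}
    {Z Z' : X × X → Set X} (h : SepFamily x y I Z Z') {p q : X × X} (hp : p ∈ I) (hq : q ∈ I)
    (hpq : p ≠ q) : (Z p ⊆ Z q ∧ Z' q ⊆ Z' p) ∨ (Z q ⊆ Z p ∧ Z' p ⊆ Z' q) :=
  (h.split p hp).subset_or_subset hnc (h.split q hq) (h.ne p hp) (h.ne q hq)
    (h.pair_ne p hp q hq hpq) (h.insep p hp) (h.insep q hq) (h.notMem_right p hp)
    (h.notMem_right q hq) (h.notMem_left p hp) (h.notMem_left q hq)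

theorem SepFamily.not_mem {x y : X} {I : Set (X × X)}
    {Z Z' : X × X → Set X} (h : SepFamily x y I Z Z') {p q : X × X} (hp : p ∈ I) (hq : q ∈ I)
    (hpq : p ≠ q) (h1 : p.1 ∈ Z q) (h1' : p.1 ∈ Z' q) (h2 : p.2 ∈ Z q) : p.2 ∉ Z' q := by
  intro h2'
  apply h.pair_ne p hp q hq hpq
  have e1 := (h.split q hq).inter p.1 h1 h1'
  have e2 := (h.split q hq).inter p.2 h2 h2'
  have := h.ne p hp
  rcases e1 with e1 | e1 <;> rcases e2 with e2 | e2 <;> simp_all [Set.pair_comm]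

theorem SepFamily.not_subset {x y : X} {I : Set (X × X)}
    {Z Z' : X × X → Set X} (h : SepFamily x y I Z Z') {p q : X × X} (hp : p ∈ I) (hq : q ∈ I)
    (hpq : p ≠ q) (hZ : Z p ⊆ Z q) : ¬ Z' p ⊆ Z' q := fun hZ' =>
  h.not_mem hp hq hpq (hZ (h.split p hp).fst_left) (hZ' (h.split p hp).fst_right)
    (hZ (h.split p hp).snd_left) (hZ' (h.split p hp).snd_right)

theorem SepFamily.exists_part [T2Space X] [CompactSpace X] (hnc : ∀ p : X, ¬CutPoint p) {x y : X}
    {I : Set (X × X)} {Z Z' : X × X → Set X} (h : SepFamily x y I Z Z') {p : X × X} (hp : p ∈ I)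
    (hlim : ∀ z ∉ Z' p, ∃ q ∈ I, q ≠ p ∧ Z q ⊆ Z p ∧ Z' p ⊆ Z' q ∧ z ∉ Z' q) :
    ∃ (s : X × X) (A B : Set X) (c : X), s ∈ I ∧ Z s ⊆ Z p ∧ Z' p ⊆ Z' s ∧ IsClosed A ∧
      IsClosed B ∧ (∀ z, z ∈ Z' s ∧ z ∈ Z p ↔ z ∈ A ∨ z ∈ B) ∧ (∀ z ∈ A, z ∉ B) ∧
      p.1 ∈ A ∧ p.2 ∈ B ∧ c ∈ A ∧ c ≠ p.1 ∧ ∀ z ∈ A, z ∈ Z s → z = c := by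
  obtain ⟨O, O', hO, hO', hpO, hpO', hOO'⟩ := t2_separation (h.ne p hp)
  have hdis := Set.disjoint_left.1 hOO'
  have hsp := h.split p hp
  let J := {q : X × X // q ∈ I ∧ q ≠ p ∧ Z q ⊆ Z p ∧ Z' p ⊆ Z' q}
  have : Nonempty J := by
    obtain ⟨q, h1, h2, h3, h4, -⟩ := hlim x (h.notMem_right p hp)
    exact ⟨⟨q, h1, h2, h3, h4⟩⟩
  obtain ⟨⟨s, hs, hsne, hsZ, hsZ'⟩, hempty⟩ :=
    ((hsp.isClosed_left).sdiff (hO.union hO')).isCompact.elim_directed_family_closed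
    (fun q : J => Z' q.1) (fun q => (h.split q.1 q.2.1).isClosed_right) (by
      ext z
      simp only [mem_inter_iff, mem_sdiff, mem_iInter, mem_empty_iff_false, iff_false]
      rintro ⟨⟨hz, hzO⟩, hall⟩
      have hz' : z ∈ Z' p := by
        by_contra hz'
        obtain ⟨q, h1, h2, h3, h4, h5⟩ := hlim z hz'
        exact h5 (hall ⟨q, h1, h2, h3, h4⟩)
      rcases hsp.inter z hz hz' with rfl | rfl
      · exact hzO (Or.inl hpO)
      · exact hzO (Or.inr hpO')) (by
      intro q r
      by_cases hqr : q.1 = r.1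
      · exact ⟨q, le_refl _, (congrArg Z' hqr).subset⟩
      · rcases h.subset_or_subset hnc q.2.1 r.2.1 hqr with h1 | h1
        · exact ⟨r, h1.2, le_refl _⟩
        · exact ⟨q, le_refl _, h1.2⟩)
  have hcov : ∀ z, z ∈ Z' s → z ∈ Z p → z ∈ O ∨ z ∈ O' := by
    intro z h1 h2
    by_contra hz
    exact (Set.ext_iff.1 hempty z).1 ⟨⟨h2, hz⟩, h1⟩
  have hss := h.split s hs
  have hA : IsClosed ((Z' s ∩ Z p) \ O') := (hss.isClosed_right.inter hsp.isClosed_left).sdiff hO'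
  have hB : IsClosed ((Z' s ∩ Z p) \ O) := (hss.isClosed_right.inter hsp.isClosed_left).sdiff hO
  have hxs : x ∈ Z s := (hss.cover x).resolve_right (h.notMem_right s hs)
  have hiff : ∀ z, z ∈ Z' s ∧ z ∈ Z p ↔ z ∈ (Z' s ∩ Z p) \ O' ∨ z ∈ (Z' s ∩ Z p) \ O := by
    intro z
    have := hcov z
    have := @hdis z
    simp only [mem_sdiff, mem_inter_iff]
    tauto
  have hd : ∀ z ∈ (Z' s ∩ Z p) \ O', z ∉ (Z' s ∩ Z p) \ O := by
    rintro z ⟨⟨h1, h2⟩, h3⟩ ⟨-, h4⟩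
    have := hcov z h1 h2
    tauto
  have h1A : p.1 ∈ (Z' s ∩ Z p) \ O' := ⟨⟨hsZ' hsp.fst_right, hsp.fst_left⟩, hdis hpO⟩
  have h2B : p.2 ∈ (Z' s ∩ Z p) \ O := ⟨⟨hsZ' hsp.snd_right, hsp.snd_left⟩, fun h => hdis h hpO'⟩
  generalize (Z' s ∩ Z p) \ O' = A at *
  generalize (Z' s ∩ Z p) \ O = B at *
  have e1 := hsp.exists_mem_part hnc hss hsZ hsZ' (h.notMem_right p hp) hxs hA hB hiff hd h1A h2B
  have e2 := hsp.swap.exists_mem_part hnc hss hsZ hsZ' (h.notMem_right p hp) hxs hB hA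
    (fun z => (hiff z).trans or_comm) (fun z h1 h2 => hd z h2 h1) h2B h1A
  have key : ∃ c c', c ∈ A ∧ c' ∈ B ∧ (∀ z, z ∈ Z s → z ∈ Z' s → z = c ∨ z = c') ∧
      c ∈ Z s ∧ c' ∈ Z s ∧ c ∈ Z' s ∧ c' ∈ Z' s := by
    have hd1 := hd s.1
    have hd2 := hd s.2
    by_cases hsA : s.1 ∈ A
    · exact ⟨s.1, s.2, hsA, by tauto, hss.inter, hss.fst_left, hss.snd_left, hss.fst_right, hss.snd_right⟩
    · exact ⟨s.2, s.1, by tauto, by tauto, fun z h1 h2 => (hss.inter z h1 h2).symm,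
        hss.snd_left, hss.fst_left, hss.snd_right, hss.fst_right⟩
  clear_value J
  clear e1 e2 hcov hpO hpO' hdis hOO' hO hO'
  obtain ⟨c, c', hcA, hcB, hin, hcs, hcs', hdt, hdt'⟩ := key
  have hAZ : ∀ z ∈ A, z ∈ Z s → z = c := by grind
  refine ⟨s, A, B, c, hs, hsZ, hsZ', hA, hB, hiff, hd, h1A, h2B, hcA, ?_, hAZ⟩
  rintro rfl
  obtain ⟨z, hz, hz'⟩ := Set.not_subset.1 (h.not_subset hs hp hsne hsZ)
  obtain ⟨q, hq, hqp, hqZ, hqZ', hzq⟩ := hlim z hz'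
  have hsq : s ≠ q := by rintro rfl; exact hzq hz
  obtain ⟨hsq1, hsq2⟩ := (h.subset_or_subset hnc hs hq hsq).resolve_right
    fun hcon => hzq (hcon.2 hz)
  have hqq := h.split q hq
  have hap := hsp.fst_right
  have hbp := hsp.snd_right
  have key : ∃ e, e ≠ p.1 ∧ e ≠ p.2 ∧ e ∉ Z s ∧ e ∈ Z q ∧ e ∈ Z' q ∧
      InsepSet ({e, p.1} : Set X) := by
    have hi := h.insep q hq
    have n1 := h.not_mem hq hs hsq.symm
    have n2 := h.not_mem hq hp hqp
    have q1 := hqq.fst_left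
    have q1' := hqq.fst_right
    have q2 := hqq.snd_left
    have q2' := hqq.snd_right
    have hne := h.ne q hq
    have ha1 := hsp.fst_left
    have hb1 := hsp.snd_left
    rcases hqq.inter p.1 (hsq1 hcs) (hqZ' hap) with hqa | hqa
    · refine ⟨q.2, ?_, ?_, ?_, q2, q2', ?_⟩
      · rw [hqa]; exact hne.symm
      · intro hq2; rw [← hqa, hq2] at n2; exact n2 ha1 hap hb1 hbp
      · rw [← hqa] at n1; exact fun h => n1 hcs hdt h (hsq2 q2')
      · rwa [hqa, Set.pair_comm]
    · have n1' := fun h1 h1' h2 h3 => n1 h3 h1 h2 h1'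
      refine ⟨q.1, ?_, ?_, ?_, q1, q1', ?_⟩
      · rw [hqa]; exact hne
      · intro hq1; rw [← hqa, hq1] at n2; exact n2 hb1 hbp ha1 hap
      · intro h1; rw [← hqa] at n1; exact n1 h1 (hsq2 q1') hcs hdt
      · rwa [hqa]
  obtain ⟨e, hea, heb, hes, heq, heq', hei⟩ := key
  have hA1 : ∀ z ∈ A, z = p.1 := by
    have hc1 := hsp.cover
    have hc2 := hss.cover
    have hin2 := hsp.inter
    rcases subset_singleton_or_of_closed_cover hnc p.1 (K := A) (K' := Z s ∪ (Z' p ∪ B)) hA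
      (hss.isClosed_left.union (hsp.isClosed_right.union hB))
      (fun z => by simp only [mem_union]; grind)
      (fun z h1 h2 => by simp only [mem_union] at h2; grind) with h1 | h1
    · exact h1
    · have := h1 p.2 (by simp [h2B]); grind
  have heB : e ∈ B := ((hiff e).1 ⟨hsq2 heq', hqZ heq⟩).resolve_left fun h => hea (hA1 e h)
  have hc1 := hsp.cover
  have hc2 := hss.cover
  have hin2 := hsp.inter
  have hab := h.ne p hp
  refine hei.false_of_closed_cover hnc (c := c') (d := p.2) (K := B) (K' := Z s ∪ (Z' p ∪ A)) hB
    (hss.isClosed_left.union (hsp.isClosed_right.union hA))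
      (fun z => by simp only [mem_union]; grind)
      (fun z h1 h2 => by simp only [mem_union] at h2; grind) heB ?_ heb (Or.inl hcs) ?_ hab
  · rintro rfl; exact hes hcs'
  · rintro h'; exact hd _ hcA (h' ▸ hcB)

theorem SepFamily.false_of_limit [T2Space X] [CompactSpace X] (hnc : ∀ p : X, ¬CutPoint p)
    {x y : X} {I : Set (X × X)} {Z Z' : X × X → Set X} (h : SepFamily x y I Z Z') {p : X × X}
    (hp : p ∈ I)
    (hlim : ∀ z ∉ Z' p, ∃ q ∈ I, q ≠ p ∧ Z q ⊆ Z p ∧ Z' p ⊆ Z' q ∧ z ∉ Z' q)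
    (hlim' : ∀ z ∉ Z p, ∃ q ∈ I, q ≠ p ∧ Z' q ⊆ Z' p ∧ Z p ⊆ Z q ∧ z ∉ Z q) : False := by
  obtain ⟨s, A, B, c, hs, hsZ, hsZ', hA, hB, hiff, hd, haA, hbB, hcA, hca, hc⟩ :=
    h.exists_part hnc hp hlim
  obtain ⟨t, A', B', c', ht, htZ', htZ, hA', hB', hiff', hd', haA', hbB', hcA', hca', hc'⟩ :=
    h.symm.exists_part hnc hp hlim'
  have hsp := h.split p hp
  have hss := h.split s hs
  have hts := h.split t ht
  have c1 := hsp.cover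
  have c2 := hss.cover
  have c3 := hts.cover
  have i1 := hsp.inter
  refine (h.insep p hp).false_of_closed_cover hnc (c := c) (d := c') (K := A ∪ A')
    (K' := Z s ∪ Z' t ∪ (B ∪ B')) (hA.union hA')
    ((hss.isClosed_left.union hts.isClosed_right).union (hB.union hB'))
    (fun z => by simp only [mem_union]; grind)
    (fun z h1 h2 => by simp only [mem_union] at h1 h2; grind) (Or.inl haA) hca.symm hca'.symm
    (Or.inr (Or.inl hbB)) ?_ ?_
  · rintro rfl; exact hd _ hcA hbB
  · rintro rfl; exact hd' _ hcA' hbB'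

theorem SepFamily.countable_isolated [SecondCountableTopology X] (hnc : ∀ p : X, ¬CutPoint p)
    {x y : X} {I : Set (X × X)} {Z Z' : X × X → Set X} (h : SepFamily x y I Z Z') :
    {p ∈ I | ∃ z ∉ Z' p, ∀ q ∈ I, q ≠ p → Z q ⊆ Z p → Z' p ⊆ Z' q → z ∈ Z' q}.Countable := by
  have key : ∀ p : X × X, ∃ O ∈ TopologicalSpace.countableBasis X,
      p ∈ {p ∈ I | ∃ z ∉ Z' p, ∀ q ∈ I, q ≠ p → Z q ⊆ Z p → Z' p ⊆ Z' q → z ∈ Z' q} →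
      ∃ z ∈ O, O ⊆ (Z' p)ᶜ ∧ ∀ q ∈ I, q ≠ p → Z q ⊆ Z p → Z' p ⊆ Z' q → z ∈ Z' q := by
    intro p
    by_cases hp : p ∈ {p ∈ I | ∃ z ∉ Z' p, ∀ q ∈ I, q ≠ p → Z q ⊆ Z p → Z' p ⊆ Z' q → z ∈ Z' q}
    · obtain ⟨hpI, z, hz, hq⟩ := hp
      obtain ⟨O, hO, hzO, hOZ⟩ :=
        (TopologicalSpace.isBasis_countableBasis X).exists_subset_of_mem_open (a := z)
          (u := (Z' p)ᶜ) hz (h.split p hpI).isClosed_right.isOpen_compl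
      exact ⟨O, hO, fun _ => ⟨z, hzO, hOZ, hq⟩⟩
    · obtain ⟨O, hO, -⟩ := (TopologicalSpace.isBasis_countableBasis X).exists_subset_of_mem_open
        (mem_univ x) isOpen_univ
      exact ⟨O, hO, fun h => absurd h hp⟩
  choose O hO hkey using key
  refine MapsTo.countable_of_injOn (f := O) (fun p _ => hO p) ?_
    (TopologicalSpace.countable_countableBasis X)
  intro p hp q hq hpq
  by_contra hne
  obtain ⟨z, hz, hzO, hall⟩ := hkey p hp
  obtain ⟨w, hw, hwO, hall'⟩ := hkey q hq
  rcases h.subset_or_subset hnc hp.1 hq.1 hne with ⟨h1, h2⟩ | ⟨h1, h2⟩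
  · exact hzO (hpq ▸ hw) (hall' p hp.1 hne h1 h2)
  · exact hwO (hpq ▸ hz) (hall q hq.1 (Ne.symm hne) h1 h2)

theorem SepFamily.countable [T2Space X] [CompactSpace X] [SecondCountableTopology X]
    (hnc : ∀ p : X, ¬CutPoint p) {x y : X} {I : Set (X × X)} {Z Z' : X × X → Set X}
    (h : SepFamily x y I Z Z') : I.Countable := by
  refine ((h.countable_isolated hnc).union (h.symm.countable_isolated hnc)).mono ?_
  intro p hp
  by_contra hcon
  simp only [mem_union, mem_ofPred_eq, hp, true_and, not_or] at hcon
  push Not at hcon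
  exact h.false_of_limit hnc hp hcon.1 hcon.2

theorem countable_insepCutPair [T2Space X] [CompactSpace X] [SecondCountableTopology X]
    (hnc : ∀ p : X, ¬CutPoint p) : {p : X × X | InsepCutPair p.1 p.2}.Countable := by
  have key : ∀ p : X × X, ∃ Z Z', InsepCutPair p.1 p.2 → Split p.1 p.2 Z Z' := by
    intro p
    by_cases hp : InsepCutPair p.1 p.2
    · obtain ⟨Z, Z', h⟩ := hp.1.exists_split
      exact ⟨Z, Z', fun _ => h⟩
    · exact ⟨∅, ∅, fun h => absurd h hp⟩
  choose Z Z' hsplit using key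
  obtain ⟨D, hD, hDd⟩ := TopologicalSpace.exists_countable_dense X
  have hb := TopologicalSpace.isBasis_countableBasis X
  let F : X × X → Set X → Set (X × X) := fun d O =>
    {p | InsepCutPair p.1 p.2 ∧ d.1 ∉ Z' p ∧ d.2 ∉ Z p ∧ p.1 ∈ O ∧ p.2 ∉ O}
  refine ((hD.prod hD).biUnion fun d _ =>
    (TopologicalSpace.countable_countableBasis X).biUnion fun O _ =>
      (?_ : (F d O).Countable)).mono ?_
  · refine SepFamily.countable hnc (x := d.1) (y := d.2) (Z := Z) (Z' := Z')
      ⟨fun p hp => hp.1.2, fun p hp => hp.1.1.1, fun p hp => hsplit p hp.1, fun p hp => hp.2.1,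
        fun p hp => hp.2.2.1, ?_⟩
    intro p hp q hq hne heq
    apply hne
    have h1 : p.1 ∈ ({q.1, q.2} : Set X) := by rw [← heq]; simp
    have h2 : p.2 ∈ ({q.1, q.2} : Set X) := by rw [← heq]; simp
    have := hp.1.1.1
    have := hp.2.2.2
    have := hq.2.2.2
    apply Prod.ext <;> grind
  · intro p hp
    have hs := hsplit p hp
    obtain ⟨z, hz, hz'⟩ := hs.exists_left
    obtain ⟨w, hw, hw'⟩ := hs.exists_right
    obtain ⟨x, hx, hxD⟩ := hDd.inter_open_nonempty _ hs.isClosed_right.isOpen_compl ⟨z, hz'⟩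
    obtain ⟨y, hy, hyD⟩ := hDd.inter_open_nonempty _ hs.isClosed_left.isOpen_compl ⟨w, hw'⟩
    obtain ⟨O, hO, hpO, hpO'⟩ := hb.exists_subset_of_mem_open (a := p.1) (u := {p.2}ᶜ)
      hp.1.1 isOpen_compl_singleton
    simp only [mem_iUnion]
    exact ⟨(x, y), ⟨hxD, hyD⟩, O, hO, hp, hx, hy, hpO, fun h => hpO' h rfl⟩

end Inseparable

section Cyclic

variable {X : Type*} [TopologicalSpace X]

theorem Split.not_both_notMem (hnc : ∀ p : X, ¬CutPoint p) {a b t t' : X} {Z Z' W W' : Set X}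
    (h : Split a b Z Z') (k : Split t t' W W') (hab : a ≠ b) (ht : t ∉ Z') (ht' : t' ∉ Z)
    (ha : a ∉ W') : b ∈ W' := by
  by_contra hb
  obtain ⟨w, hw, hwW⟩ := k.exists_right
  have key : ∀ {t t' : X} {Z Z' : Set X}, Split a b Z Z' → Split t t' W W' → t ∉ Z' → t' ∉ Z →
      ∀ z ∈ W', z ∈ Z → z = t := by
    intro t t' Z Z' h k ht ht' z hz hzZ
    have c1 := h.cover
    have c2 := k.cover
    have i1 := h.inter
    have i2 := k.inter
    have m1 := h.fst_right
    have m2 := h.snd_right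
    rcases subset_singleton_or_of_closed_cover hnc t (K := W' ∩ Z) (K' := W ∪ Z')
      (k.isClosed_right.inter h.isClosed_left) (k.isClosed_left.union h.isClosed_right)
      (fun z => by simp only [mem_union, mem_inter_iff]; grind)
      (fun z h1 h2 => by simp only [mem_union, mem_inter_iff] at h1 h2; grind) with h1 | h1
    · exact h1 z ⟨hz, hzZ⟩
    · exact absurd ((h1 a (Or.inr m1)).trans (h1 b (Or.inr m2)).symm) hab
  have k1 := k.fst_left
  have k2 := k.snd_left
  rcases h.cover w with hz | hz
  · have := key h k ht ht' w hw hz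
    grind
  · have := key h.symm k.swap ht' ht w hw hz
    grind

theorem Split.exists_crossing [T1Space X] (hnc : ∀ p : X, ¬CutPoint p) {a b t t' : X}
    {Z Z' : Set X} (h : Split a b Z Z') (hab : a ≠ b) (ht : t ∉ Z') (ht' : t' ∉ Z)
    (hc : CutPair t t') : ∃ W W', Split t t' W W' ∧ a ∉ W' ∧ b ∉ W := by
  obtain ⟨W, W', k⟩ := hc.exists_split
  have e1 := h.not_both_notMem hnc k hab ht ht'
  have e2 := h.not_both_notMem hnc k.symm hab ht ht'
  have m1 := h.fst_left
  have m2 := h.fst_right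
  have m3 := h.snd_left
  have m4 := h.snd_right
  have c := k.cover a
  have c' := k.cover b
  have i := k.inter
  by_cases ha : a ∈ W'
  · exact ⟨W', W, k.symm, by grind, by by_cases ha' : a ∈ W <;> grind⟩
  · exact ⟨W, W', k, ha, by grind⟩

/-- A cyclic decomposition of `X` by three points. -/
structure Triad (a b c : X) (P Q R : Set X) : Prop where
  isClosed_fst : IsClosed P
  isClosed_snd : IsClosed Q
  isClosed_trd : IsClosed R
  cover : ∀ z, z ∈ P ∨ z ∈ Q ∨ z ∈ R
  inter_fst_snd : ∀ z, z ∈ P ∧ z ∈ Q ↔ z = b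
  inter_snd_trd : ∀ z, z ∈ Q ∧ z ∈ R ↔ z = c
  inter_trd_fst : ∀ z, z ∈ R ∧ z ∈ P ↔ z = a
  ne_fst_snd : a ≠ b
  ne_snd_trd : b ≠ c
  ne_trd_fst : c ≠ a

/-- A cyclic decomposition of `X` by four points. -/
structure Tetrad (a b c d : X) (A B C D : Set X) : Prop where
  isClosed_fst : IsClosed A
  isClosed_snd : IsClosed B
  isClosed_trd : IsClosed C
  isClosed_fth : IsClosed D
  cover : ∀ z, z ∈ A ∨ z ∈ B ∨ z ∈ C ∨ z ∈ D
  inter_fst_snd : ∀ z, z ∈ A ∧ z ∈ B ↔ z = b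
  inter_snd_trd : ∀ z, z ∈ B ∧ z ∈ C ↔ z = c
  inter_trd_fth : ∀ z, z ∈ C ∧ z ∈ D ↔ z = d
  inter_fth_fst : ∀ z, z ∈ D ∧ z ∈ A ↔ z = a
  inter_fst_trd : ∀ z ∈ A, z ∉ C
  inter_snd_fth : ∀ z ∈ B, z ∉ D

def Tri (a b c : X) : Prop := ∃ P Q R, Triad a b c P Q R

def Quad (a b c d : X) : Prop := ∃ A B C D, Tetrad a b c d A B C D

theorem Triad.rotate {a b c : X} {P Q R : Set X} (h : Triad a b c P Q R) : Triad b c a Q R P :=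
  ⟨h.2, h.3, h.1, fun z => by have := h.4 z; tauto, h.6, h.7, h.5, h.9, h.10, h.8⟩

theorem Triad.swap {a b c : X} {P Q R : Set X} (h : Triad a b c P Q R) : Triad b a c P R Q :=
  ⟨h.1, h.3, h.2, fun z => by have := h.4 z; tauto, fun z => and_comm.trans (h.7 z),
    fun z => and_comm.trans (h.6 z), fun z => and_comm.trans (h.5 z), h.8.symm, h.10.symm, h.9.symm⟩

theorem Tri.rotate {a b c : X} (h : Tri a b c) : Tri b c a := by
  obtain ⟨P, Q, R, h⟩ := h
  exact ⟨_, _, _, h.rotate⟩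

theorem Tri.swap {a b c : X} (h : Tri a b c) : Tri b a c := by
  obtain ⟨P, Q, R, h⟩ := h
  exact ⟨_, _, _, h.swap⟩

theorem Tetrad.rotate {a b c d : X} {A B C D : Set X} (h : Tetrad a b c d A B C D) :
    Tetrad b c d a B C D A :=
  ⟨h.2, h.3, h.4, h.1, fun z => by have := h.5 z; tauto, h.7, h.8, h.9, h.6, h.11,
    fun z h1 h2 => h.10 z h2 h1⟩

theorem Quad.rotate {a b c d : X} (h : Quad a b c d) : Quad b c d a := by
  obtain ⟨A, B, C, D, h⟩ := h
  exact ⟨_, _, _, _, h.rotate⟩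

theorem Tetrad.swap {a b c d : X} {A B C D : Set X} (h : Tetrad a b c d A B C D) :
    Tetrad b a d c A D C B :=
  ⟨h.1, h.4, h.3, h.2, fun z => by have := h.5 z; tauto, fun z => and_comm.trans (h.9 z),
    fun z => and_comm.trans (h.8 z), fun z => and_comm.trans (h.7 z),
    fun z => and_comm.trans (h.6 z), h.10, fun z h1 h2 => h.11 z h2 h1⟩

theorem Triad.split (hnc : ∀ p : X, ¬CutPoint p) {a b c : X} {P Q R : Set X}
    (h : Triad a b c P Q R) : Split a b P (Q ∪ R) := by
  obtain ⟨h1, h2, h3, h4, h5, h6, h7, h8, h9, h10⟩ := h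
  refine ⟨h1, h2.union h3, ?_, ?_, ?_, ?_, ?_, ?_, ?_, ⟨c, ?_, ?_⟩⟩
  all_goals try simp only [mem_union]
  iterate 6 grind
  · by_contra! hcon
    rcases subset_singleton_or_of_closed_cover hnc c h2 h3 (by grind) (by grind) with e | e
    · have := e b; grind
    · have := e a; grind
  · grind
  · grind

theorem Tri.cutPair (hnc : ∀ p : X, ¬CutPoint p) {a b c : X} (h : Tri a b c) : CutPair a b := by
  obtain ⟨P, Q, R, h⟩ := h
  exact (h.split hnc).cutPair hnc h.ne_fst_snd

theorem Tetrad.triad {a b c d : X} {A B C D : Set X} (h : Tetrad a b c d A B C D) :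
    Triad a b c A B (C ∪ D) := by
  obtain ⟨h1, h2, h3, h4, h5, h6, h7, h8, h9, h10, h11⟩ := h
  have e1 := (h6 b).2 rfl
  have e2 := (h7 c).2 rfl
  have e3 := (h8 d).2 rfl
  have e4 := (h9 a).2 rfl
  refine ⟨h1, h2, h3.union h4, ?_, ?_, ?_, ?_, ?_, ?_, ?_⟩
  all_goals try simp only [mem_union]
  iterate 4 grind
  · rintro rfl; exact h11 _ e1.2 e4.1
  · rintro rfl; exact h10 _ e1.1 e2.2
  · rintro rfl; exact h11 _ e2.1 e4.1

theorem Quad.tri {a b c d : X} (h : Quad a b c d) : Tri a b c := by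
  obtain ⟨A, B, C, D, h⟩ := h
  exact ⟨_, _, _, h.triad⟩

theorem Split.quad [T1Space X] (hnc : ∀ p : X, ¬CutPoint p) {a b t t' : X}
    {Z Z' : Set X} (h : Split a b Z Z') (hab : a ≠ b) (ht : t ∉ Z') (ht' : t' ∉ Z)
    (hc : CutPair t t') : Quad a t b t' := by
  obtain ⟨W, W', k, ha, hb⟩ := h.exists_crossing hnc hab ht ht' hc
  obtain ⟨h1, h2, h3, h4, h5, h6, h7, h8, h9, h10⟩ := h
  obtain ⟨k1, k2, k3, k4, k5, k6, k7, k8, k9, k10⟩ := k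
  refine ⟨Z ∩ W, Z ∩ W', Z' ∩ W', Z' ∩ W, h1.inter k1, h1.inter k2, h2.inter k2, h2.inter k1,
    ?_, ?_, ?_, ?_, ?_, ?_, ?_⟩
  all_goals try simp only [mem_inter_iff]
  all_goals clear h9 h10 k9 k10 hc hnc
  · grind
  all_goals intro z; have := h4 z; have := k4 z; grind

theorem Triad.quad [T1Space X] (hnc : ∀ p : X, ¬CutPoint p) {a b c d : X} {P Q R : Set X}
    (h : Triad a b c P Q R) (hd : d ∈ P) (hda : d ≠ a) (hdb : d ≠ b) (hc : CutPair d c) :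
    Quad a d b c := by
  have hs := h.split hnc
  have := hs.inter d hd
  refine hs.quad hnc h.ne_fst_snd (by tauto) (fun h' => ?_) hc
  have h1 := (h.inter_snd_trd c).2 rfl
  have h2 := h.inter_fst_snd c
  have := h.ne_snd_trd
  grind

theorem Tri.exists_quad [T1Space X] (hnc : ∀ p : X, ¬CutPoint p) {a b c d : X}
    (h : Tri a b c) (hda : CutPair d a) (hdb : CutPair d b) (hdc : CutPair d c) :
    Quad a d b c ∨ Quad b d c a ∨ Quad c d a b := by
  obtain ⟨P, Q, R, h⟩ := h
  rcases h.cover d with hd | hd | hd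
  · exact Or.inl (h.quad hnc hd hda.1 hdb.1 hdc)
  · exact Or.inr (Or.inl (h.rotate.quad hnc hd hdb.1 hdc.1 hda))
  · exact Or.inr (Or.inr (h.rotate.rotate.quad hnc hd hdc.1 hda.1 hdb))

theorem Tri.replace [T1Space X] (hnc : ∀ p : X, ¬CutPoint p) {a b c d : X}
    (h : Tri a b c) (hda : CutPair d a) (hdb : CutPair d b) (hdc : CutPair d c) :
    Tri d b c := by
  rcases h.exists_quad hnc hda hdb hdc with h | h | h
  · exact h.rotate.tri
  · exact h.tri.swap
  · exact h.rotate.rotate.rotate.tri.rotate.rotate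

/-- A fifth point which forms cut pairs with two opposite points of a cyclic quadruple
does so with the other two. -/
theorem Tetrad.cutPair_of_mem [T1Space X] (hnc : ∀ p : X, ¬CutPoint p) {a b c d t : X}
    {A B C D : Set X} (h : Tetrad a b c d A B C D) (ht : t ∈ A) (hta : t ≠ a) (htb : t ≠ b)
    (hc : CutPair t c) : CutPair t b ∧ CutPair t d := by
  have hq := h.triad
  refine ⟨(hq.quad hnc ht hta htb hc).rotate.tri.cutPair hnc, ?_⟩
  have hs := hq.split hnc
  obtain ⟨W, W', k, ha, hb⟩ := hs.exists_crossing hnc (t := t) (t' := c) hq.ne_fst_snd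
    (fun h' => by have := hs.inter t ht h'; tauto) (fun h' => by
      have := h.inter_fst_trd c h'
      have := (h.inter_snd_trd c).2 rfl
      tauto) hc
  obtain ⟨h1, h2, h3, h4, h5, h6, h7, h8, h9, h10, h11⟩ := h
  obtain ⟨k1, k2, k3, k4, k5, k6, k7, k8, -, -⟩ := k
  refine Split.cutPair hnc (Z := (A ∩ W') ∪ (B ∪ C)) (Z' := (A ∩ W) ∪ D) ⟨(h1.inter k2).union
    (h2.union h3), (h1.inter k1).union h4, ?_, ?_, ?_, ?_, ?_, ?_, ⟨b, ?_, ?_⟩, ⟨a, ?_, ?_⟩⟩ ?_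
  all_goals clear hs hq hnc hc
  all_goals try simp only [mem_union, mem_inter_iff]
  · intro z; have := h5 z; have := k3 z; tauto
  · intro z; have := k4 z; grind
  all_goals grind

theorem Quad.cutPair [T1Space X] (hnc : ∀ p : X, ¬CutPoint p) {a b c d t : X}
    (h : Quad a b c d) (hta : CutPair t a) (htc : CutPair t c) (htb : t ≠ b) (htd : t ≠ d) :
    CutPair t b ∧ CutPair t d := by
  obtain ⟨A, B, C, D, h⟩ := h
  rcases h.cover t with ht | ht | ht | ht
  · exact h.cutPair_of_mem hnc ht hta.1 htb htc
  · exact (h.rotate.swap.cutPair_of_mem hnc ht htc.1 htb hta)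
  · exact (h.rotate.rotate.cutPair_of_mem hnc ht htc.1 htd hta).symm
  · exact (h.rotate.rotate.rotate.swap.cutPair_of_mem hnc ht hta.1 htd htc).symm

end Cyclic

section CyclicSets

variable {X : Type*} [TopologicalSpace X]

theorem Split.isConnected (hnc : ∀ p : X, ¬CutPoint p) {a b : X} {Z Z' : Set X}
    (h : Split a b Z Z') (hab : a ≠ b) : IsConnected Z := by
  refine ⟨⟨a, h.fst_left⟩, ?_⟩
  rw [isPreconnected_iff_subset_of_fully_disjoint_closed h.isClosed_left]
  have hc := h.cover
  have hi := h.inter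
  obtain ⟨h1, h2, -, -, ha, ha', hb, hb', ⟨w, hw, hw'⟩, -⟩ := h
  have key : ∀ u v : Set X, IsClosed u → IsClosed v → Z ⊆ u ∪ v → Disjoint u v → a ∈ u →
      Z ⊆ u := by
    intro u v hu hv hsub hd hau
    have hd := Set.disjoint_left.1 hd
    have hsub : ∀ z ∈ Z, z ∈ u ∨ z ∈ v := fun z hz => hsub hz
    by_cases hbu : b ∈ u
    · rcases subset_singleton_or_of_closed_cover hnc a (K := Z ∩ v) (K' := (Z ∩ u) ∪ Z')
        (h1.inter hv) ((h1.inter hu).union h2)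
        (fun z => by simp only [mem_union, mem_inter_iff]; grind)
        (fun z k1 k2 => by simp only [mem_union, mem_inter_iff] at k1 k2; grind) with e | e
      · intro z hz
        rcases hsub z hz with k | k
        · exact k
        · exact e z ⟨hz, k⟩ ▸ hau
      · exact absurd (e b (Or.inr hb')).symm hab
    · have hbv : b ∈ v := by grind
      exfalso
      rcases subset_singleton_or_of_closed_cover hnc b (K := Z ∩ v) (K' := (Z ∩ u) ∪ Z')
        (h1.inter hv) ((h1.inter hu).union h2)
        (fun z => by simp only [mem_union, mem_inter_iff]; grind)
        (fun z k1 k2 => by simp only [mem_union, mem_inter_iff] at k1 k2; grind) with e | e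
      · rcases subset_singleton_or_of_closed_cover hnc a (K := Z ∩ u) (K' := (Z ∩ v) ∪ Z')
          (h1.inter hu) ((h1.inter hv).union h2)
          (fun z => by simp only [mem_union, mem_inter_iff]; grind)
          (fun z k1 k2 => by simp only [mem_union, mem_inter_iff] at k1 k2; grind) with e' | e'
        · rcases hsub w hw with k | k
          · exact hw' (e' w ⟨hw, k⟩ ▸ ha')
          · exact hw' (e w ⟨hw, k⟩ ▸ hb')
        · exact absurd (e' b (Or.inr hb')).symm hab
      · exact absurd (e a (Or.inr ha')) hab
  intro u v hu hv hsub hd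
  rcases hsub ha with k | k
  · exact Or.inl (key u v hu hv hsub hd k)
  · exact Or.inr (key v u hv hu (by rwa [union_comm]) hd.symm k)

/-- A cyclic decomposition of `X` by the points `x 0, …, x m`. -/
structure Cyc (m : ℕ) (x : ℕ → X) (M : ℕ → Set X) : Prop where
  two_le : 2 ≤ m
  isClosed : ∀ i ≤ m, IsClosed (M i)
  cover : ∀ z, ∃ i ≤ m, z ∈ M i
  inter_succ : ∀ i < m, ∀ z, z ∈ M i ∧ z ∈ M (i + 1) ↔ z = x (i + 1)
  inter_last : ∀ z, z ∈ M m ∧ z ∈ M 0 ↔ z = x 0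
  disjoint : ∀ i j, i + 1 < j → j ≤ m → (0 < i ∨ j < m) → ∀ z ∈ M i, z ∉ M j
  ne : ∀ i j, i < j → j ≤ m → x i ≠ x j

theorem Triad.cyc {a b c : X} {P Q R : Set X} (h : Triad a b c P Q R) :
    Cyc 2 (fun i => if i = 0 then a else if i = 1 then b else c)
      (fun i => if i = 0 then P else if i = 1 then Q else R) := by
  obtain ⟨h1, h2, h3, h4, h5, h6, h7, h8, h9, h10⟩ := h
  refine ⟨le_rfl, ?_, ?_, ?_, ?_, ?_, ?_⟩
  · intro i hi; interval_cases i <;> simpa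
  · intro z
    rcases h4 z with h | h | h
    exacts [⟨0, by simp, by simpa⟩, ⟨1, by simp, by simpa⟩, ⟨2, by simp, by simpa⟩]
  · intro i hi; interval_cases i <;> simpa
  · simpa
  · intro i j hi hj h; omega
  · intro i j hi hj
    interval_cases j <;> interval_cases i <;> simp [h8, h9, h10.symm]

theorem Cyc.rotate {m : ℕ} {x : ℕ → X} {M : ℕ → Set X} (h : Cyc m x M) :
    Cyc m (fun i => if i = m then x 0 else x (i + 1)) (fun i => if i = m then M 0 else M (i + 1)) := by
  obtain ⟨h1, h2, h3, h4, h5, h6, h7⟩ := h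
  refine ⟨h1, ?_, ?_, ?_, ?_, ?_, ?_⟩
  · intro i hi
    split_ifs with hm
    · exact h2 0 (by omega)
    · exact h2 _ (by omega)
  · intro z
    obtain ⟨i, hi, hz⟩ := h3 z
    rcases i with - | i
    · exact ⟨m, le_rfl, by simpa⟩
    · exact ⟨i, by omega, by simpa [show i ≠ m by omega]⟩
  · intro i hi z
    rcases eq_or_ne (i + 1) m with e | e
    · simpa [e, show i ≠ m by omega] using h5 z
    · simpa [e, show i ≠ m by omega] using h4 (i + 1) (by omega) z
  · intro z
    simpa [show 0 ≠ m by omega, and_comm] using h4 0 (by omega) z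
  · intro i j hij hj h z hz hz'
    rcases eq_or_ne j m with e | e
    · simp only [e, if_true, show i ≠ m by omega, if_false] at hz hz'
      exact h6 0 (i + 1) (by omega) (by omega) (by omega) z hz' hz
    · simp only [e, show i ≠ m by omega, if_false] at hz hz'
      exact h6 (i + 1) (j + 1) (by omega) (by omega) (by omega) z hz hz'
  · intro i j hij hj
    rcases eq_or_ne j m with e | e
    · simpa [e, show i ≠ m by omega] using (h7 0 (i + 1) (by omega) (by omega)).symm
    · simpa [e, show i ≠ m by omega] using h7 (i + 1) (j + 1) (by omega) (by omega)

theorem image_rotate {α : Type*} (m : ℕ) (x : ℕ → α) :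
    Set.image (fun i => if i = m then x 0 else x (i + 1)) (Iic m) = Set.image x (Iic m) := by
  ext z
  simp only [mem_image, mem_Iic]
  constructor
  · rintro ⟨i, hi, rfl⟩
    split_ifs with hm
    · exact ⟨0, by omega, rfl⟩
    · exact ⟨i + 1, by omega, rfl⟩
  · rintro ⟨i, hi, rfl⟩
    rcases i with - | i
    · exact ⟨m, le_rfl, by simp⟩
    · exact ⟨i, by omega, by simp [show i ≠ m by omega]⟩

theorem Cyc.exists_rotate {m : ℕ} {x : ℕ → X} {M : ℕ → Set X} (h : Cyc m x M) {k : ℕ}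
    (hk : k ≤ m) : ∃ x' M', Cyc m x' M' ∧ M' m = M k ∧ Set.image x' (Iic m) = Set.image x (Iic m) := by
  induction k generalizing x M with
  | zero => exact ⟨_, _, h.rotate, by simp, image_rotate m x⟩
  | succ k ih =>
    obtain ⟨x', M', h', e, e'⟩ := ih h.rotate (by omega)
    exact ⟨x', M', h', by simpa [show k ≠ m by omega] using e, e'.trans (image_rotate m x)⟩

theorem Cyc.mem_left {m : ℕ} {x : ℕ → X} {M : ℕ → Set X} (h : Cyc m x M) {i : ℕ} (hi : i ≤ m) :
    x i ∈ M i := by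
  rcases i with - | i
  · exact ((h.inter_last _).2 rfl).2
  · exact ((h.inter_succ i (by omega) _).2 rfl).2

theorem Cyc.mem_right {m : ℕ} {x : ℕ → X} {M : ℕ → Set X} (h : Cyc m x M) {i : ℕ} (hi : i < m) :
    x (i + 1) ∈ M i :=
  ((h.inter_succ i hi _).2 rfl).1

theorem Cyc.triad {m : ℕ} {x : ℕ → X} {M : ℕ → Set X} (h : Cyc m x M) :
    Triad (x m) (x 0) (x 1) (M m) (M 0) (⋃ i ∈ Ico 1 m, M i) := by
  have h1 := h.two_le
  refine ⟨h.isClosed m le_rfl, h.isClosed 0 (by omega),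
    (finite_Ico 1 m).isClosed_biUnion fun i hi => h.isClosed i hi.2.le, ?_, h.inter_last, ?_, ?_,
    (h.ne 0 m (by omega) le_rfl).symm, h.ne 0 1 (by omega) (by omega), h.ne 1 m (by omega) le_rfl⟩
  · intro z
    obtain ⟨i, hi, hz⟩ := h.cover z
    simp only [mem_iUnion, mem_Ico]
    rcases eq_or_ne i 0 with rfl | e
    · exact Or.inr (Or.inl hz)
    rcases eq_or_ne i m with rfl | e'
    · exact Or.inl hz
    exact Or.inr (Or.inr ⟨i, ⟨by omega, by omega⟩, hz⟩)
  · intro z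
    simp only [mem_iUnion, mem_Ico]
    constructor
    · rintro ⟨hz, i, hi, hz'⟩
      rcases eq_or_ne i 1 with rfl | e
      · exact (h.inter_succ 0 (by omega) z).1 ⟨hz, hz'⟩
      · exact absurd hz' (h.disjoint 0 i (by omega) (by omega) (by omega) z hz)
    · rintro rfl
      exact ⟨h.mem_right (by omega), 1, ⟨le_rfl, by omega⟩, h.mem_left (by omega)⟩
  · intro z
    simp only [mem_iUnion, mem_Ico]
    obtain ⟨k, rfl⟩ : ∃ k, m = k + 1 := ⟨m - 1, by omega⟩
    constructor
    · rintro ⟨⟨i, hi, hz'⟩, hz⟩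
      rcases eq_or_ne i k with rfl | e
      · exact (h.inter_succ i (by omega) z).1 ⟨hz', hz⟩
      · exact absurd hz (h.disjoint i (k + 1) (by omega) (by omega) (by omega) z hz')
    · rintro rfl
      exact ⟨⟨k, ⟨by omega, by omega⟩, h.mem_right (by omega)⟩, h.mem_left le_rfl⟩

theorem Triad.exists_crossing [T1Space X] (hnc : ∀ p : X, ¬CutPoint p) {a b c t : X} {P Q R : Set X}
    (h : Triad a b c P Q R) (ht : t ∈ P) (hta : t ≠ a) (htb : t ≠ b) (hc : CutPair t c) :
    c ∉ P ∧ ∃ W W', Split t c W W' ∧ a ∉ W' ∧ b ∉ W := by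
  have hs := h.split hnc
  have := hs.inter t ht
  have hcP : c ∉ P := fun h' => by
    have h1 := (h.inter_snd_trd c).2 rfl
    have h2 := h.inter_fst_snd c
    have := h.ne_snd_trd
    grind
  exact ⟨hcP, hs.exists_crossing hnc h.ne_fst_snd (by tauto) hcP hc⟩

theorem Cyc.exists_insert_last [T1Space X] (hnc : ∀ p : X, ¬CutPoint p) {m : ℕ} {x : ℕ → X}
    {M : ℕ → Set X} {t : X} (h : Cyc m x M) (ht : t ∈ M m) (hc : ∀ s ∈ Set.image x (Iic m), CutPair t s) :
    ∃ x' M', Cyc (m + 1) x' M' ∧ Set.image x' (Iic (m + 1)) = insert t (Set.image x (Iic m)) := by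
  have hm := h.two_le
  have hc' : ∀ i ≤ m, CutPair t (x i) := fun i hi => hc _ ⟨i, hi, rfl⟩
  obtain ⟨hx, W, W', k, ha, hb⟩ := h.triad.exists_crossing hnc ht (hc' m le_rfl).1
    (hc' 0 (by omega)).1 (hc' 1 (by omega))
  have kc := k.cover
  have ki := k.inter
  have hlast : ∀ i < m, ∀ z ∈ M i, z ∈ M m → z = x 0 ∧ i = 0 ∨ z = x m ∧ i + 1 = m := by
    intro i hi z hz hz'
    rcases eq_or_ne i 0 with rfl | e
    · exact Or.inl ⟨(h.inter_last z).1 ⟨hz', hz⟩, rfl⟩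
    rcases eq_or_ne (i + 1) m with rfl | e'
    · exact Or.inr ⟨(h.inter_succ i hi z).1 ⟨hz, hz'⟩, rfl⟩
    · exact absurd hz' (h.disjoint i m (by omega) le_rfl (by omega) z hz)
  refine ⟨fun i => if i ≤ m then x i else t,
    fun i => if i < m then M i else if i = m then M m ∩ W else M m ∩ W', ⟨by omega, ?_, ?_, ?_, ?_,
    ?_, ?_⟩, ?_⟩
  · intro i hi
    split_ifs with h1 h2
    · exact h.isClosed i h1.le
    · exact (h.isClosed m le_rfl).inter k.isClosed_left
    · exact (h.isClosed m le_rfl).inter k.isClosed_right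
  · intro z
    obtain ⟨i, hi, hz⟩ := h.cover z
    rcases hi.lt_or_eq with e | rfl
    · exact ⟨i, by omega, by simpa [e]⟩
    rcases kc z with hw | hw
    · exact ⟨i, by omega, by simpa using ⟨hz, hw⟩⟩
    · exact ⟨i + 1, by omega, by simpa using ⟨hz, hw⟩⟩
  · intro i hi z
    rcases eq_or_ne i m with rfl | e
    · simp only [lt_irrefl, if_false, if_true, mem_inter_iff, show ¬ i + 1 < i by omega,
        show ¬ i + 1 = i by omega, show ¬ i + 1 ≤ i by omega]
      constructor
      · rintro ⟨⟨h1, h2⟩, -, h3⟩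
        rcases ki z h2 h3 with e | e
        · exact e
        · exact absurd (e ▸ h1) hx
      · rintro rfl
        exact ⟨⟨ht, k.fst_left⟩, ht, k.fst_right⟩
    rcases eq_or_ne (i + 1) m with rfl | e'
    · have := h.inter_succ i (by omega) z
      have := kc z
      simp only [lt_irrefl, if_false, if_true, mem_inter_iff, show i < i + 1 by omega, le_refl]
      grind
    · simpa [show i < m by omega, show i + 1 < m by omega, show i + 1 ≤ m by omega] using
        h.inter_succ i (by omega) z
  · intro z
    have := h.inter_last z
    have := kc z
    simp only [show ¬ m + 1 < m by omega, show ¬ m + 1 = m by omega, show 0 < m by omega,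
      if_true, if_false, Nat.zero_le, mem_inter_iff]
    grind
  · intro i j hij hj hij' z hz hz'
    simp only [show i < m by omega, if_true] at hz
    split_ifs at hz' with h1 h2
    · exact h.disjoint i j hij h1.le (Or.inr h1) z hz hz'
    · rcases hlast i (by omega) z hz hz'.1 with e | e
      · exact hb (e.1 ▸ hz'.2)
      · omega
    · rcases hlast i (by omega) z hz hz'.1 with e | e
      · omega
      · exact ha (e.1 ▸ hz'.2)
  · intro i j hij hj
    rcases eq_or_ne j (m + 1) with rfl | e
    · simpa [show i ≤ m by omega] using (hc' i (by omega)).1.symm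
    · simpa [show i ≤ m by omega, show j ≤ m by omega] using h.ne i j hij (by omega)
  · ext z
    simp only [mem_image, mem_Iic, mem_insert_iff]
    constructor
    · rintro ⟨i, hi, rfl⟩
      split_ifs with h1
      · exact Or.inr ⟨i, h1, rfl⟩
      · exact Or.inl rfl
    · rintro (rfl | ⟨i, hi, rfl⟩)
      · exact ⟨m + 1, le_rfl, by simp⟩
      · exact ⟨i, by omega, by simp [hi]⟩

theorem Cyc.exists_insert [T1Space X] (hnc : ∀ p : X, ¬CutPoint p) {m : ℕ} {x : ℕ → X}
    {M : ℕ → Set X} {t : X} (h : Cyc m x M) (hc : ∀ s ∈ Set.image x (Iic m), CutPair t s) :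
    ∃ x' M', Cyc (m + 1) x' M' ∧ Set.image x' (Iic (m + 1)) = insert t (Set.image x (Iic m)) := by
  obtain ⟨i, hi, ht⟩ := h.cover t
  obtain ⟨x', M', h', e, e'⟩ := h.exists_rotate hi
  rw [← e'] at hc ⊢
  exact h'.exists_insert_last hnc (e ▸ ht) hc

theorem Cyc.cyclicDecomp [CompactSpace X] (hnc : ∀ p : X, ¬CutPoint p) {m : ℕ} {x : ℕ → X}
    {M : ℕ → Set X} (h : Cyc m x M) :
    CyclicDecomp (m + 1) (fun i => x i.val) (fun i => M i.val) := by
  have hm := h.two_le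
  have hlt : ∀ i : ZMod (m + 1), i.val ≤ m := fun i => Nat.lt_succ_iff.1 (ZMod.val_lt i)
  have hval : ∀ i : ZMod (m + 1), (i + 1).val = if i.val = m then (0 : ℕ) else i.val + 1 := by
    intro i
    have h1 : (1 : ZMod (m + 1)).val = 1 := by
      rw [ZMod.val_one_eq_one_mod, Nat.mod_eq_of_lt (by omega)]
    rw [ZMod.val_add, h1]
    split_ifs with e
    · rw [e, Nat.mod_self]
    · exact Nat.mod_eq_of_lt (by have := hlt i; omega)
  have hinj : ∀ i j : ZMod (m + 1), i.val = j.val → i = j := fun i j e => ZMod.val_injective _ e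
  refine ⟨by omega, ?_, ?_, ?_, ?_, ?_⟩
  · intro i j hij
    by_contra hne
    rcases lt_or_gt_of_ne fun e => hne (hinj i j e) with e | e
    · exact h.ne _ _ e (hlt j) hij
    · exact h.ne _ _ e (hlt i) hij.symm
  · intro i
    obtain ⟨x', M', h', e, -⟩ := h.exists_rotate (hlt i)
    have := (h'.triad.split hnc).isConnected hnc h'.triad.ne_fst_snd
    rw [e] at this
    exact ⟨(h.isClosed _ (hlt i)).isCompact, this⟩
  · intro i
    ext z
    have := hlt i
    change z ∈ M i.val ∧ z ∈ M (i + 1).val ↔ z = x (i + 1).val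
    rw [hval i]
    split_ifs with e
    · rw [e]; exact h.inter_last z
    · exact h.inter_succ _ (by omega) z
  · have key : ∀ i j : ZMod (m + 1), i.val < j.val → j ≠ i + 1 → i ≠ j + 1 →
        ∀ z ∈ M i.val, z ∉ M j.val := by
      intro i j h1 h2 h3
      have h2' : j.val ≠ (i + 1).val := fun e => h2 (hinj _ _ e)
      have h3' : i.val ≠ (j + 1).val := fun e => h3 (hinj _ _ e)
      rw [hval] at h2' h3'
      have := hlt j
      refine h.disjoint _ _ ?_ ?_ ?_
      · split_ifs at h2' <;> omega
      · omega
      · split_ifs at h3' <;> omega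
    intro i j h1 h2 h3
    ext z
    simp only [mem_inter_iff, mem_empty_iff_false, iff_false, not_and]
    intro hz hz'
    rcases lt_or_gt_of_ne fun e => h1 (hinj i j e) with e | e
    · exact key i j e h2 h3 z hz hz'
    · exact key j i e h3 h2 z hz' hz
  · refine eq_univ_of_forall fun z => ?_
    obtain ⟨i, hi, hz⟩ := h.cover z
    refine mem_iUnion.2 ⟨(i : ZMod (m + 1)), ?_⟩
    rwa [ZMod.val_cast_of_lt (by omega)]

theorem Tri.of_pairwise_cutPair [T1Space X] (hnc : ∀ p : X, ¬CutPoint p) {S : Set X}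
    (hS : ∀ a ∈ S, ∀ b ∈ S, a ≠ b → CutPair a b) {p q r : X} (h : Tri p q r)
    (hp : p ∈ S) (hq : q ∈ S) (hr : r ∈ S) {a b c : X} (ha : a ∈ S) (hb : b ∈ S) (hc : c ∈ S)
    (hab : a ≠ b) (hbc : b ≠ c) (hca : c ≠ a) : Tri a b c := by
  have key : ∀ {p q r d : X}, Tri p q r → p ∈ S → q ∈ S → r ∈ S → d ∈ S → d ≠ q → d ≠ r →
      Tri d q r := by
    intro p q r d h hp hq hr hd h1 h2
    rcases eq_or_ne d p with rfl | e
    · exact h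
    · exact h.replace hnc (hS d hd p hp e) (hS d hd q hq h1) (hS d hd r hr h2)
  have step : ∃ q ∈ S, ∃ r ∈ S, Tri a q r := by
    by_cases h1 : a = q
    · subst h1; exact ⟨r, hr, p, hp, h.rotate⟩
    by_cases h2 : a = r
    · subst h2; exact ⟨p, hp, q, hq, h.rotate.rotate⟩
    exact ⟨q, hq, r, hr, key h hp hq hr ha h1 h2⟩
  obtain ⟨q, hq, r, hr, h⟩ := step
  have step : ∃ r ∈ S, Tri a b r := by
    by_cases h1 : b = r
    · subst h1; exact ⟨q, hq, h.rotate.rotate.swap⟩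
    exact ⟨r, hr, (key h.rotate hq hr ha hb h1 hab.symm).rotate.rotate⟩
  obtain ⟨r, hr, h⟩ := step
  exact (key h.rotate.rotate hr ha hb hc hca hbc.symm).rotate

theorem CyclicSet.of_pairwise_cutPair [T1Space X] [CompactSpace X] (hnc : ∀ p : X, ¬CutPoint p)
    {S : Set X} (hS : ∀ a ∈ S, ∀ b ∈ S, a ≠ b → CutPair a b) {p q r : X} (h : Tri p q r)
    (hp : p ∈ S) (hq : q ∈ S) (hr : r ∈ S) : CyclicSet S := by
  classical
  have key : ∀ m ≥ 2, ∀ A : Finset X, ↑A ⊆ S → A.card = m + 1 →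
      ∃ x M, Cyc m x M ∧ Set.image x (Iic m) = (A : Set X) := by
    intro m hm
    induction m, hm using Nat.le_induction with
    | base =>
      intro A hA hcard
      obtain ⟨a, b, c, hab, hac, hbc, rfl⟩ := Finset.card_eq_three.1 hcard
      have hA' : ∀ s, s = a ∨ s = b ∨ s = c → s ∈ S := fun s hs => hA (by simpa using hs)
      obtain ⟨P, Q, R, h⟩ := Tri.of_pairwise_cutPair hnc hS h hp hq hr (hA' a (by simp))
        (hA' b (by simp)) (hA' c (by simp)) hab hbc hac.symm
      refine ⟨_, _, h.cyc, ?_⟩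
      ext z
      simp only [mem_image, mem_Iic, Finset.coe_insert, Finset.coe_singleton, mem_insert_iff,
        mem_singleton_iff]
      constructor
      · rintro ⟨i, hi, rfl⟩
        interval_cases i <;> simp
      · rintro (rfl | rfl | rfl)
        exacts [⟨0, by simp, by simp⟩, ⟨1, by simp, by simp⟩, ⟨2, by simp, by simp⟩]
    | succ m hm ih =>
      intro A hA hcard
      obtain ⟨t, A, ht, rfl, hcard'⟩ := Finset.card_eq_succ.1 hcard
      rw [Finset.coe_insert, insert_subset_iff] at hA
      obtain ⟨x, M, hx, e⟩ := ih A hA.2 hcard'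
      obtain ⟨x', M', hx', e'⟩ := hx.exists_insert hnc (t := t) (by
        rw [e]
        exact fun s hs => hS t hA.1 s (hA.2 hs) (fun h => ht (h ▸ hs)))
      exact ⟨x', M', hx', by rw [e', e, Finset.coe_insert]⟩
  intro A hA hcard
  rcases eq_or_ne A.card 2 with h2 | h2
  · obtain ⟨a, b, hab, rfl⟩ := Finset.card_eq_two.1 h2
    exact Or.inl ⟨a, b, hS a (hA (by simp)) b (hA (by simp)) hab, by simp⟩
  · obtain ⟨x, M, h, e⟩ := key (A.card - 1) (by omega) A hA (by omega)
    refine Or.inr ⟨_, _, _, h.cyclicDecomp hnc, ?_⟩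
    rw [← e]
    ext z
    simp only [mem_image, mem_Iic, mem_range]
    constructor
    · rintro ⟨i, hi, rfl⟩
      exact ⟨(i : ZMod (A.card - 1 + 1)), by rw [ZMod.val_cast_of_lt (by omega)]⟩
    · rintro ⟨i, rfl⟩
      exact ⟨i.val, Nat.lt_succ_iff.1 (ZMod.val_lt i), rfl⟩

end CyclicSets

section Necklaces

variable {X : Type*} [TopologicalSpace X]

theorem CyclicSet.cutPair {S : Set X} (h : CyclicSet S) {a b : X} (ha : a ∈ S) (hb : b ∈ S)
    (hab : a ≠ b) : CutPair a b := by
  classical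
  rcases h {a, b} (by simp [insert_subset_iff, ha, hb]) (by simp [Finset.card_pair hab]) with
    ⟨c, d, hcd, e⟩ | ⟨n, x, M, ⟨hn, hx, -⟩, e⟩
  · rw [Finset.coe_pair, pair_eq_pair_iff] at e
    rcases e with ⟨rfl, rfl⟩ | ⟨rfl, rfl⟩
    exacts [hcd, hcd.symm]
  · have h1 : (range x).ncard = n := by
      rw [ncard_range_of_injective hx, Nat.card_zmod]
    rw [← e, Finset.coe_pair, ncard_pair hab] at h1
    omega

theorem CyclicSet.exists_triad [T2Space X] {S : Set X} (h : CyclicSet S) {a b c : X} (ha : a ∈ S) (hb : b ∈ S)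
    (hc : c ∈ S) (hab : a ≠ b) (hac : a ≠ c) (hbc : b ≠ c) :
    ∃ x ∈ S, ∃ y ∈ S, ∃ z ∈ S, ∃ P Q R, Triad x y z P Q R := by
  classical
  have hcard : ({a, b, c} : Finset X).card = 3 := Finset.card_eq_three.2 ⟨a, b, c, hab, hac, hbc, rfl⟩
  have hsub : (({a, b, c} : Finset X) : Set X) ⊆ S := by simp [insert_subset_iff, ha, hb, hc]
  have hncard : (({a, b, c} : Finset X) : Set X).ncard = 3 := by rw [ncard_coe_finset, hcard]
  rcases h {a, b, c} hsub (by omega) with ⟨d, e, hde, k⟩ | ⟨n, x, M, ⟨hn, hx, h1, h2, h3, h4⟩, k⟩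
  · rw [k, ncard_pair hde.1] at hncard
    omega
  · rw [k] at hncard hsub
    rw [ncard_range_of_injective hx, Nat.card_zmod] at hncard
    subst hncard
    rw [range_subset_iff] at hsub
    have e1 := h2 0
    have e2 := h2 1
    have e3 := h2 2
    simp only [Set.ext_iff, mem_inter_iff, mem_singleton_iff] at e1 e2 e3
    refine ⟨x 0, hsub 0, x 1, hsub 1, x 2, hsub 2, M 0, M 1, M 2, (h1 0).1.isClosed,
      (h1 1).1.isClosed, (h1 2).1.isClosed, fun z => ?_, e1, e2, e3, hx.ne (by decide),
      hx.ne (by decide), hx.ne (by decide)⟩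
    obtain ⟨i, hi⟩ := mem_iUnion.1 (h4.ge (mem_univ z))
    fin_cases i
    exacts [Or.inl hi, Or.inr (Or.inl hi), Or.inr (Or.inr hi)]

theorem Necklace.cutPair {S : Set X} (h : Necklace S) {a b : X} (ha : a ∈ S) (hb : b ∈ S)
    (hab : a ≠ b) : CutPair a b :=
  h.1.cutPair ha hb hab

theorem Necklace.exists_triad [T2Space X] {S : Set X} (h : Necklace S) :
    ∃ a ∈ S, ∃ b ∈ S, ∃ c ∈ S, ∃ P Q R, Triad a b c P Q R := by
  obtain ⟨a, ha, b, hb, c, hc, hab, hac, hbc⟩ := h.2.1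
  exact h.1.exists_triad ha hb hc hab hac hbc

theorem Necklace.mem_of_cutPair [T2Space X] [CompactSpace X] (hnc : ∀ p : X, ¬CutPoint p)
    {S : Set X} (h : Necklace S) {t : X} (ht : ∀ s ∈ S, t ≠ s → CutPair t s) : t ∈ S := by
  obtain ⟨a, ha, b, hb, c, hc, P, Q, R, hT⟩ := h.exists_triad
  have hcyc : CyclicSet (insert t S) := by
    refine CyclicSet.of_pairwise_cutPair hnc ?_ ⟨P, Q, R, hT⟩ (Or.inr ha) (Or.inr hb) (Or.inr hc)
    rintro u (rfl | hu) v (rfl | hv) huv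
    · exact absurd rfl huv
    · exact ht v hv huv
    · exact (ht u hu huv.symm).symm
    · exact h.cutPair hu hv huv
  rw [← h.2.2 _ hcyc (subset_insert t S)]
  exact mem_insert t S

theorem Necklace.subset_of_three [T2Space X] [CompactSpace X] (hnc : ∀ p : X, ¬CutPoint p)
    {S T : Set X} (hS : Necklace S) (hT : Necklace T) {a b c : X} (h : Tri a b c) (ha : a ∈ S)
    (hb : b ∈ S) (hc : c ∈ S) (ha' : a ∈ T) (hb' : b ∈ T) (hc' : c ∈ T) : T ⊆ S := by
  intro t ht
  by_contra htS
  refine htS (hS.mem_of_cutPair hnc fun s hs hts => ?_)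
  by_cases hsT : s ∈ T
  · exact hT.cutPair ht hsT hts
  have h1 : ∀ u ∈ S, u ∈ T → t ≠ u ∧ CutPair t u ∧ CutPair s u := by
    intro u hu hu'
    have e : t ≠ u := fun e => htS (e ▸ hu)
    exact ⟨e, hT.cutPair ht hu' e, hS.cutPair hs hu fun e => hsT (e ▸ hu')⟩
  obtain ⟨na, ta, sa⟩ := h1 a ha ha'
  obtain ⟨nb, tb, sb⟩ := h1 b hb hb'
  obtain ⟨nc, tc, sc⟩ := h1 c hc hc'
  rcases h.exists_quad hnc sa sb sc with h | h | h
  · exact (h.cutPair hnc ta tb hts nc).1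
  · exact (h.cutPair hnc tb tc hts na).1
  · exact (h.cutPair hnc tc ta hts nb).1

theorem Necklace.eq_of_three [T2Space X] [CompactSpace X] (hnc : ∀ p : X, ¬CutPoint p)
    {S T : Set X} (hS : Necklace S) (hT : Necklace T) {a b c : X} (h : Tri a b c) (ha : a ∈ S)
    (hb : b ∈ S) (hc : c ∈ S) (ha' : a ∈ T) (hb' : b ∈ T) (hc' : c ∈ T) : S = T :=
  (hT.subset_of_three hnc hS h ha' hb' hc' ha hb hc).antisymm
    (hS.subset_of_three hnc hT h ha hb hc ha' hb' hc')

theorem Necklace.mem_of_quad [T2Space X] [CompactSpace X] (hnc : ∀ p : X, ¬CutPoint p)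
    {T : Set X} (hT : Necklace T) {a b t t' : X} (h : Quad a t b t') (hab : CutPair a b)
    (ht : t ∈ T) (ht' : t' ∈ T) : a ∈ T := by
  refine hT.mem_of_cutPair hnc fun u hu hau => ?_
  by_cases h1 : u = t
  · exact h1 ▸ h.tri.cutPair hnc
  by_cases h2 : u = t'
  · exact h2 ▸ (h.rotate.rotate.rotate.tri.cutPair hnc).symm
  by_cases h3 : u = b
  · exact h3 ▸ hab
  exact (h.rotate.cutPair hnc (hT.cutPair hu ht h1) (hT.cutPair hu ht' h2) h3 hau.symm).2.symm

theorem Necklace.eq_of_quad [T2Space X] [CompactSpace X] (hnc : ∀ p : X, ¬CutPoint p)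
    {S T : Set X} (hS : Necklace S) (hT : Necklace T) {a b t t' : X} (h : Quad a t b t')
    (ha : a ∈ S) (hb : b ∈ S) (ht : t ∈ T) (ht' : t' ∈ T) : S = T := by
  have hab : CutPair a b := (h.tri.rotate.rotate.cutPair hnc).symm
  have hab' : CutPair t t' := (h.rotate.tri.rotate.rotate.cutPair hnc).symm
  exact hS.eq_of_three hnc hT h.tri ha (hS.mem_of_quad hnc h.rotate hab' hb ha) hb
    (hT.mem_of_quad hnc h hab ht ht') ht (hT.mem_of_quad hnc h.rotate.rotate hab.symm ht' ht)

theorem Triad.snd_right_mem (hnc : ∀ p : X, ¬CutPoint p) {a b c a' b' c' y : X}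
    {P Q R P' Q' R' : Set X} (h : Triad a b c P Q R) (h' : Triad a' b' c' P' Q' R')
    (hb' : b' ∈ P) (hc' : c' ∈ P) (hy : y ∈ Q) (hy' : y ∈ Q') (hyP : y ∉ P) : c ∈ Q' := by
  by_contra hc
  have e1 := (h.inter_fst_snd b).2 rfl
  have e2 := (h.inter_trd_fst a).2 rfl
  have hcov : ∀ z, z ∈ Q ∩ Q' ∨ z ∈ (Q ∩ (P' ∪ R')) ∪ (P ∪ R) := by
    intro z
    have := h.cover z
    have := h'.cover z
    simp only [mem_union, mem_inter_iff]
    tauto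
  have hmeet : ∀ z, z ∈ Q ∩ Q' → z ∈ (Q ∩ (P' ∪ R')) ∪ (P ∪ R) → z = b := by
    intro z h1 h2
    simp only [mem_union, mem_inter_iff] at h1 h2
    have f1 := h.inter_fst_snd z
    have f2 := h.inter_snd_trd z
    have f3 := h'.inter_fst_snd z
    have f4 := h'.inter_snd_trd z
    grind
  rcases subset_singleton_or_of_closed_cover hnc b (h.isClosed_snd.inter h'.isClosed_snd)
    ((h.isClosed_snd.inter (h'.isClosed_fst.union h'.isClosed_trd)).union
      (h.isClosed_fst.union h.isClosed_trd)) hcov hmeet with e | e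
  · exact hyP (e y ⟨hy, hy'⟩ ▸ e1.1)
  · exact h.ne_fst_snd (e a (Or.inr (Or.inl e2.2)))

theorem Triad.false_of_mem_fst (hnc : ∀ p : X, ¬CutPoint p) {a b c a' b' c' y z : X}
    {P Q R P' Q' R' : Set X} (h : Triad a b c P Q R) (h' : Triad a' b' c' P' Q' R')
    (ha' : a' ∈ P) (hb' : b' ∈ P) (hc' : c' ∈ P) (hy : y ∈ Q) (hy' : y ∈ Q') (hyP : y ∉ P)
    (hz : z ∈ R) (hz' : z ∈ R') (hzP : z ∉ P) : False := by
  have h1 := h.snd_right_mem hnc h' hb' hc' hy hy' hyP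
  have h2 := h.swap.snd_right_mem hnc h'.swap ha' hc' hz hz' hzP
  have h3 := (h'.inter_snd_trd c).1 ⟨h1, h2⟩
  have h4 := (h.inter_snd_trd c).2 rfl
  exact h.ne_snd_trd ((h.inter_fst_snd c).1 ⟨h3 ▸ hc', h4.1⟩).symm

theorem Necklace.eq_of_triad [T2Space X] [CompactSpace X] (hnc : ∀ p : X, ¬CutPoint p)
    {S T : Set X} (hS : Necklace S) (hT : Necklace T) {a b c t t' : X} {P Q R : Set X}
    (h : Triad a b c P Q R) (ha : a ∈ S) (hb : b ∈ S) (ht : t ∈ T) (ht' : t' ∈ T) (htP : t ∈ P)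
    (hta : t ≠ a) (htb : t ≠ b) (htP' : t' ∉ P) : S = T := by
  have hs := h.split hnc
  have := hs.inter t htP
  exact hS.eq_of_quad hnc hT (hs.quad hnc h.ne_fst_snd (by tauto) htP'
    (hT.cutPair ht ht' fun e => htP' (e ▸ htP))) ha hb ht ht'

theorem Necklace.eq_of_common_points [T2Space X] [CompactSpace X] (hnc : ∀ p : X, ¬CutPoint p)
    {S T : Set X} (hS : Necklace S) (hT : Necklace T) {a b c a' b' c' x y z : X}
    {P Q R P' Q' R' : Set X} (h : Triad a b c P Q R) (h' : Triad a' b' c' P' Q' R')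
    (ha : a ∈ S) (hb : b ∈ S) (hc : c ∈ S) (ha' : a' ∈ T) (hb' : b' ∈ T) (hc' : c' ∈ T)
    (hx : x ∉ Q ∪ R) (hy : y ∉ R ∪ P) (hz : z ∉ P ∪ Q)
    (hx' : x ∉ Q' ∪ R') (hy' : y ∉ R' ∪ P') (hz' : z ∉ P' ∪ Q') : S = T := by
  simp only [mem_union, not_or] at hx hy hz hx' hy' hz'
  have hxP := (h.cover x).resolve_right fun k => k.elim hx.1 hx.2
  have hyP := (h.rotate.cover y).resolve_right fun k => k.elim hy.1 hy.2
  have hzP := (h.rotate.rotate.cover z).resolve_right fun k => k.elim hz.1 hz.2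
  have hxP' := (h'.cover x).resolve_right fun k => k.elim hx'.1 hx'.2
  have hyP' := (h'.rotate.cover y).resolve_right fun k => k.elim hy'.1 hy'.2
  have hzP' := (h'.rotate.rotate.cover z).resolve_right fun k => k.elim hz'.1 hz'.2
  by_contra hne
  have hP : ∃ t ∈ T, t ∉ P := by
    by_contra! hcon
    exact h.false_of_mem_fst hnc h' (hcon _ ha') (hcon _ hb') (hcon _ hc') hyP hyP' hy.2 hzP hzP'
      hz.1
  have hQ : ∃ t ∈ T, t ∉ Q := by
    by_contra! hcon
    exact h.rotate.false_of_mem_fst hnc h'.rotate (hcon _ hb') (hcon _ hc') (hcon _ ha') hzP hzP'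
      hz.2 hxP hxP' hx.1
  have hR : ∃ t ∈ T, t ∉ R := by
    by_contra! hcon
    exact h.rotate.rotate.false_of_mem_fst hnc h'.rotate.rotate (hcon _ hc') (hcon _ ha')
      (hcon _ hb') hxP hxP' hx.2 hyP hyP' hy.1
  have hsub : ∀ t ∈ T, t ∈ S := by
    intro t ht
    by_contra htS
    have na : t ≠ a := fun e => htS (e ▸ ha)
    have nb : t ≠ b := fun e => htS (e ▸ hb)
    have nc : t ≠ c := fun e => htS (e ▸ hc)
    rcases h.cover t with k | k | k
    · obtain ⟨t', ht', k'⟩ := hP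
      exact hne (hS.eq_of_triad hnc hT h ha hb ht ht' k na nb k')
    · obtain ⟨t', ht', k'⟩ := hQ
      exact hne (hS.eq_of_triad hnc hT h.rotate hb hc ht ht' k nb nc k')
    · obtain ⟨t', ht', k'⟩ := hR
      exact hne (hS.eq_of_triad hnc hT h.rotate.rotate hc ha ht ht' k nc na k')
  exact hne (hS.eq_of_three hnc hT ⟨_, _, _, h'⟩ (hsub _ ha') (hsub _ hb') (hsub _ hc') ha' hb' hc')

theorem countable_necklace [T2Space X] [CompactSpace X] [TopologicalSpace.SeparableSpace X]
    (hnc : ∀ p : X, ¬CutPoint p) : {S : Set X | Necklace S}.Countable := by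
  obtain ⟨D, hD, hDd⟩ := TopologicalSpace.exists_countable_dense X
  rcases isEmpty_or_nonempty X with hX | ⟨⟨x₀⟩⟩
  · exact to_countable _
  have key : ∀ S : Set X, ∃ p : X × X × X, Necklace S → p ∈ D ×ˢ D ×ˢ D ∧
      ∃ a ∈ S, ∃ b ∈ S, ∃ c ∈ S, ∃ P Q R, Triad a b c P Q R ∧
        p.1 ∉ Q ∪ R ∧ p.2.1 ∉ R ∪ P ∧ p.2.2 ∉ P ∪ Q := by
    intro S
    by_cases hS : Necklace S
    · obtain ⟨a, ha, b, hb, c, hc, P, Q, R, h⟩ := hS.exists_triad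
      have hpt : ∀ {a b c : X} {P Q R : Set X}, Triad a b c P Q R → ∃ x ∈ D, x ∉ Q ∪ R := by
        intro a b c P Q R h
        have hs := h.split hnc
        obtain ⟨w, -, hw⟩ := hs.exists_left
        obtain ⟨x, hx, hxD⟩ := hDd.inter_open_nonempty _ hs.isClosed_right.isOpen_compl ⟨w, hw⟩
        exact ⟨x, hxD, hx⟩
      obtain ⟨x, hxD, hx⟩ := hpt h
      obtain ⟨y, hyD, hy⟩ := hpt h.rotate
      obtain ⟨z, hzD, hz⟩ := hpt h.rotate.rotate
      exact ⟨(x, y, z), fun _ => ⟨⟨hxD, hyD, hzD⟩, a, ha, b, hb, c, hc, P, Q, R, h, hx, hy, hz⟩⟩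
    · exact ⟨(x₀, x₀, x₀), fun h => absurd h hS⟩
  choose f hf using key
  refine MapsTo.countable_of_injOn (f := f) (fun S hS => (hf S hS).1) ?_
    (hD.prod (hD.prod hD))
  intro S hS T hT hST
  obtain ⟨-, a, ha, b, hb, c, hc, P, Q, R, h, hx, hy, hz⟩ := hf S hS
  obtain ⟨-, a', ha', b', hb', c', hc', P', Q', R', h', hx', hy', hz'⟩ := hf T hT
  rw [← hST] at hx' hy' hz'
  exact Necklace.eq_of_common_points hnc hS hT h h' ha hb hc ha' hb' hc' hx hy hz hx' hy' hz'

end Necklaces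

theorem stmt14 {X : Type*} [MetricSpace X] [CompactSpace X] [ConnectedSpace X]
    (hnc : ∀ p : X, ¬CutPoint p) :
    {p : X × X | InsepCutPair p.1 p.2}.Countable ∧
    {S : Set X | Necklace S}.Countable :=
  ⟨countable_insepCutPair hnc, countable_necklace hnc⟩
end

section
/- Let G be a group acting by homeomorphisms on an R-tree T with a non-nesting action, where every element of G is elliptic. Then G fixes a point of T or fixes an end of T. -/
open Set

section TreeDefs

/-- `A` is an arc from `a` to `b`: a homeomorphic image of `[0,1]` with endpoints `a,b`. -/
def ArcFrom {T : Type*} [TopologicalSpace T] (a b : T) (A : Set T) : Prop :=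
  ∃ f : ℝ → T, ContinuousOn f (Set.Icc 0 1) ∧ Set.InjOn f (Set.Icc 0 1) ∧
    f 0 = a ∧ f 1 = b ∧ f '' Set.Icc 0 1 = A

/-- `T` is uniquely arcwise connected: any two distinct points are joined by a
unique arc. Together with metrizability this is the definition of an `ℝ`-tree. -/
def IsRTree (T : Type*) [TopologicalSpace T] : Prop :=
  ∀ a b : T, a ≠ b →
    (∃ A : Set T, ArcFrom a b A) ∧
    ∀ A A' : Set T, ArcFrom a b A → ArcFrom a b A' → A = A'

/-- The action is non-nesting: no group element maps a closed arc properly into itself. -/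
def NonNesting (G T : Type*) [TopologicalSpace T] [Group G] [MulAction G T] : Prop :=
  ∀ (g : G) (a b : T) (A : Set T), ArcFrom a b A → ¬((fun x => g • x) '' A ⊂ A)

/-- A ray: a subspace homeomorphic to `[0,∞)`. -/
def IsRay {T : Type*} [TopologicalSpace T] (R : Set T) : Prop :=
  Nonempty (↥R ≃ₜ ↥(Set.Ici (0 : ℝ)))

end TreeDefs

section Segments

variable {T : Type*} [TopologicalSpace T]

/-- The segment joining `a` to `b`: the points lying on an arc from `a` to `b`, or `{a}` if
`a = b`. -/
def treeSeg (a b : T) : Set T := {x | (a = b ∧ x = a) ∨ ∃ A, ArcFrom a b A ∧ x ∈ A}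

theorem ArcFrom.ne {a b : T} {A : Set T} (h : ArcFrom a b A) : a ≠ b := by
  obtain ⟨f, -, hi, rfl, rfl, -⟩ := h
  intro h
  have := hi (by simp) (by simp) h
  norm_num at this

theorem arcFrom_image_Icc {f : ℝ → T} {s t : ℝ} (hst : s < t) (hc : ContinuousOn f (Icc s t))
    (hi : InjOn f (Icc s t)) : ArcFrom (f s) (f t) (f '' Icc s t) := by
  have hpos : 0 < t - s := sub_pos.2 hst
  have hmap : MapsTo (fun u : ℝ => s + (t - s) * u) (Icc 0 1) (Icc s t) := by
    intro u hu
    constructor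
    · nlinarith [hu.1]
    · nlinarith [hu.2]
  refine ⟨fun u => f (s + (t - s) * u), hc.comp (by fun_prop) hmap, ?_, by simp, by simp, ?_⟩
  · intro u hu v hv huv
    have := hi (hmap hu) (hmap hv) huv
    have h2 : (t - s) * u = (t - s) * v := by linarith
    exact mul_left_cancel₀ hpos.ne' h2
  · apply Subset.antisymm
    · rintro _ ⟨u, hu, rfl⟩
      exact ⟨_, hmap hu, rfl⟩
    · rintro _ ⟨v, hv, rfl⟩
      refine ⟨(v - s) / (t - s), ⟨div_nonneg (by linarith [hv.1]) hpos.le, ?_⟩, ?_⟩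
      · rw [div_le_one hpos]
        linarith [hv.2]
      · change f _ = f v
        congr 1
        field_simp
        ring

theorem ArcFrom.symm {a b : T} {A : Set T} (h : ArcFrom a b A) : ArcFrom b a A := by
  obtain ⟨f, hc, hi, rfl, rfl, rfl⟩ := h
  have hmap : MapsTo (fun u : ℝ => 1 - u) (Icc 0 1) (Icc 0 1) := by
    intro u hu
    constructor <;> linarith [hu.1, hu.2]
  refine ⟨fun u => f (1 - u), hc.comp (by fun_prop) hmap, ?_, by simp, by simp, ?_⟩
  · intro u hu v hv huv
    have := hi (hmap hu) (hmap hv) huv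
    linarith
  · apply Subset.antisymm
    · rintro _ ⟨u, hu, rfl⟩
      exact ⟨_, hmap hu, rfl⟩
    · rintro _ ⟨v, hv, rfl⟩
      exact ⟨1 - v, hmap hv, by simp⟩

theorem treeSeg_self (a : T) : treeSeg a a = {a} := by
  ext x
  constructor
  · rintro (⟨-, rfl⟩ | ⟨A, hA, -⟩)
    · rfl
    · exact absurd rfl hA.ne
  · rintro rfl
    exact Or.inl ⟨rfl, rfl⟩

theorem treeSeg_comm (a b : T) : treeSeg a b = treeSeg b a := by
  have key : ∀ a b : T, treeSeg a b ⊆ treeSeg b a := by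
    rintro a b x (⟨rfl, rfl⟩ | ⟨A, hA, hx⟩)
    · exact Or.inl ⟨rfl, rfl⟩
    · exact Or.inr ⟨A, hA.symm, hx⟩
  exact Subset.antisymm (key a b) (key b a)

theorem IsRTree.treeSeg_eq (hT : IsRTree T) {a b : T} {A : Set T} (h : ArcFrom a b A) :
    treeSeg a b = A := by
  ext x
  constructor
  · rintro (⟨hab, -⟩ | ⟨B, hB, hx⟩)
    · exact absurd hab h.ne
    · rwa [(hT a b h.ne).2 A B h hB]
  · exact fun hx => Or.inr ⟨A, h, hx⟩

theorem IsRTree.image_Icc_eq (hT : IsRTree T) {f : ℝ → T} {s t : ℝ} (hst : s ≤ t)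
    (hc : ContinuousOn f (Icc s t)) (hi : InjOn f (Icc s t)) :
    f '' Icc s t = treeSeg (f s) (f t) := by
  rcases hst.eq_or_lt with rfl | h
  · simp [treeSeg_self]
  · exact (hT.treeSeg_eq (arcFrom_image_Icc h hc hi)).symm

theorem IsRTree.exists_param (hT : IsRTree T) (a b : T) :
    ∃ f : ℝ → T, ContinuousOn f (Icc 0 1) ∧ f 0 = a ∧ f 1 = b ∧ (a ≠ b → InjOn f (Icc 0 1)) ∧
      ∀ s t, 0 ≤ s → s ≤ t → t ≤ 1 → f '' Icc s t = treeSeg (f s) (f t) := by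
  by_cases hab : a = b
  · subst hab
    refine ⟨fun _ => a, continuousOn_const, rfl, rfl, fun h => absurd rfl h, ?_⟩
    intro s t _ hst _
    rw [treeSeg_self]
    exact (nonempty_Icc.2 hst).image_const a
  · obtain ⟨A, f, hc, hi, h0, h1, -⟩ := (hT a b hab).1
    refine ⟨f, hc, h0, h1, fun _ => hi, ?_⟩
    intro s t hs hst ht
    have hsub : Icc s t ⊆ Icc 0 1 := Icc_subset_Icc hs ht
    exact hT.image_Icc_eq hst (hc.mono hsub) (hi.mono hsub)

theorem IsRTree.left_mem (hT : IsRTree T) (a b : T) : a ∈ treeSeg a b := by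
  obtain ⟨f, -, rfl, rfl, -, h⟩ := hT.exists_param a b
  rw [← h 0 1 le_rfl zero_le_one le_rfl]
  exact ⟨0, by simp, rfl⟩

theorem IsRTree.right_mem (hT : IsRTree T) (a b : T) : b ∈ treeSeg a b := by
  rw [treeSeg_comm]
  exact hT.left_mem b a

theorem IsRTree.isCompact_treeSeg (hT : IsRTree T) (a b : T) : IsCompact (treeSeg a b) := by
  obtain ⟨f, hc, rfl, rfl, -, h⟩ := hT.exists_param a b
  rw [← h 0 1 le_rfl zero_le_one le_rfl]
  exact isCompact_Icc.image_of_continuousOn hc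

theorem IsRTree.treeSeg_subset_left (hT : IsRTree T) {a b x : T} (hx : x ∈ treeSeg a b) :
    treeSeg a x ⊆ treeSeg a b := by
  obtain ⟨f, -, rfl, rfl, -, h⟩ := hT.exists_param a b
  rw [← h 0 1 le_rfl zero_le_one le_rfl] at hx ⊢
  obtain ⟨s, hs, rfl⟩ := hx
  rw [← h 0 s le_rfl hs.1 hs.2]
  exact image_mono (Icc_subset_Icc le_rfl hs.2)

theorem IsRTree.treeSeg_subset_right (hT : IsRTree T) {a b x : T} (hx : x ∈ treeSeg a b) :
    treeSeg x b ⊆ treeSeg a b := by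
  rw [treeSeg_comm a b] at hx ⊢
  rw [treeSeg_comm x b]
  exact hT.treeSeg_subset_left hx

theorem IsRTree.eq_of_mem_of_mem (hT : IsRTree T) {a x y : T} (hx : x ∈ treeSeg a y)
    (hy : y ∈ treeSeg a x) : x = y := by
  by_cases hay : a = y
  · subst hay
    simpa [treeSeg_self] using hx
  obtain ⟨f, -, rfl, rfl, hi, h⟩ := hT.exists_param a y
  rw [← h 0 1 le_rfl zero_le_one le_rfl] at hx
  obtain ⟨s, hs, rfl⟩ := hx
  rw [← h 0 s le_rfl hs.1 hs.2] at hy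
  obtain ⟨t, ht, hty⟩ := hy
  have := hi hay ⟨ht.1, ht.2.trans hs.2⟩ (by simp) hty
  have h1 : s = 1 := le_antisymm hs.2 (this ▸ ht.2)
  rw [h1]

theorem IsRTree.total (hT : IsRTree T) {a b x y : T} (hx : x ∈ treeSeg a b)
    (hy : y ∈ treeSeg a b) : x ∈ treeSeg a y ∨ y ∈ treeSeg a x := by
  obtain ⟨f, -, rfl, rfl, -, h⟩ := hT.exists_param a b
  rw [← h 0 1 le_rfl zero_le_one le_rfl] at hx hy
  obtain ⟨s, hs, rfl⟩ := hx
  obtain ⟨t, ht, rfl⟩ := hy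
  rw [← h 0 s le_rfl hs.1 hs.2, ← h 0 t le_rfl ht.1 ht.2]
  rcases le_total s t with hst | hst
  · exact Or.inl ⟨s, ⟨hs.1, hst⟩, rfl⟩
  · exact Or.inr ⟨t, ⟨ht.1, hst⟩, rfl⟩

theorem IsRTree.mem_of_mem_of_mem (hT : IsRTree T) {a x y b : T} (hx : x ∈ treeSeg a y)
    (hy : y ∈ treeSeg a b) : y ∈ treeSeg x b := by
  obtain ⟨f, -, rfl, rfl, -, h⟩ := hT.exists_param a b
  rw [← h 0 1 le_rfl zero_le_one le_rfl] at hy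
  obtain ⟨t, ht, rfl⟩ := hy
  rw [← h 0 t le_rfl ht.1 ht.2] at hx
  obtain ⟨s, hs, rfl⟩ := hx
  rw [← h s 1 hs.1 (hs.2.trans ht.2) le_rfl]
  exact ⟨t, ⟨hs.2, ht.2⟩, rfl⟩

/-- In the order with least element `p`, a segment lies between its endpoints. -/
theorem IsRTree.between (hT : IsRTree T) {p a b x : T} (hab : a ∈ treeSeg p b)
    (hx : x ∈ treeSeg a b) : a ∈ treeSeg p x ∧ x ∈ treeSeg p b := by
  refine ⟨?_, hT.treeSeg_subset_right hab hx⟩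
  obtain ⟨f, -, rfl, rfl, -, h⟩ := hT.exists_param p b
  rw [← h 0 1 le_rfl zero_le_one le_rfl] at hab
  obtain ⟨s, hs, rfl⟩ := hab
  rw [← h s 1 hs.1 hs.2 le_rfl] at hx
  obtain ⟨t, ht, rfl⟩ := hx
  rw [← h 0 t le_rfl (hs.1.trans ht.1) ht.2]
  exact ⟨s, ⟨hs.1, ht.1⟩, rfl⟩

/-- Concatenation of two segments meeting only at their common endpoint. -/
theorem IsRTree.mem_of_inter_subset (hT : IsRTree T) {a m b : T}
    (h : ∀ x ∈ treeSeg a m, x ∈ treeSeg m b → x = m) : m ∈ treeSeg a b := by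
  by_cases ham : a = m
  · rw [ham]
    exact hT.left_mem _ _
  by_cases hmb : m = b
  · rw [hmb]
    exact hT.right_mem _ _
  obtain ⟨f, hfc, hf0, hf1, hfi, hf⟩ := hT.exists_param a m
  obtain ⟨g, hgc, hg0, hg1, hgi, hg⟩ := hT.exists_param m b
  have hfS := hf 0 1 le_rfl zero_le_one le_rfl
  have hgS := hg 0 1 le_rfl zero_le_one le_rfl
  rw [hf0, hf1] at hfS
  rw [hg0, hg1] at hgS
  let k : ℝ → T := fun t => if t ≤ 1 then f t else g (t - 1)
  have hk1 : EqOn k f (Icc 0 1) := fun t ht => if_pos ht.2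
  have hk2 : EqOn k (fun t => g (t - 1)) (Icc 1 2) := by
    intro t ht
    by_cases h1 : t ≤ 1
    · have : t = 1 := le_antisymm h1 ht.1
      subst this
      simp [k, hf1, hg0]
    · exact if_neg h1
  have hmap : MapsTo (fun t : ℝ => t - 1) (Icc 1 2) (Icc 0 1) := by
    intro t ht
    constructor <;> linarith [ht.1, ht.2]
  have hkc : ContinuousOn k (Icc 0 2) := by
    rw [← Icc_union_Icc_eq_Icc (zero_le_one (α := ℝ)) (by norm_num : (1 : ℝ) ≤ 2)]
    refine (hfc.congr hk1).union_of_isClosed ?_ isClosed_Icc isClosed_Icc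
    exact (hgc.comp (by fun_prop) hmap).congr hk2
  have cross : ∀ s ∈ Icc (0 : ℝ) 1, ∀ t ∈ Icc (1 : ℝ) 2, k s = k t → s = t := by
    intro s hs t ht hst
    have hx : k s = m := by
      apply h
      · rw [← hfS, hk1 hs]
        exact ⟨s, hs, rfl⟩
      · rw [← hgS, hst, hk2 ht]
        exact ⟨t - 1, hmap ht, rfl⟩
    have h1 : s = 1 := hfi ham hs (by simp) (by rw [hf1, ← hk1 hs, hx])
    have h2 : t - 1 = 0 := by
      apply hgi hmb (hmap ht) (by simp)
      rw [hg0, ← hx, hst]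
      exact (hk2 ht).symm
    linarith
  have hki : InjOn k (Icc 0 2) := by
    intro s hs t ht hst
    rcases le_total s 1 with h1 | h1 <;> rcases le_total t 1 with h2 | h2
    · exact hfi ham ⟨hs.1, h1⟩ ⟨ht.1, h2⟩ (by rwa [hk1 ⟨hs.1, h1⟩, hk1 ⟨ht.1, h2⟩] at hst)
    · exact cross s ⟨hs.1, h1⟩ t ⟨h2, ht.2⟩ hst
    · exact (cross t ⟨ht.1, h2⟩ s ⟨h1, hs.2⟩ hst.symm).symm
    · have := hgi hmb (hmap ⟨h1, hs.2⟩) (hmap ⟨h2, ht.2⟩)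
        (by rwa [hk2 ⟨h1, hs.2⟩, hk2 ⟨h2, ht.2⟩] at hst)
      simpa using this
  have key := hT.image_Icc_eq (by norm_num : (0 : ℝ) ≤ 2) hkc hki
  have e0 : k 0 = a := by simp [k, hf0]
  have e1 : k 1 = m := by simp [k, hf1]
  have e2 : k 2 = b := by
    have := hk2 (x := 2) (by norm_num)
    rw [this]
    norm_num [hg1]
  rw [e0, e2] at key
  rw [← key]
  exact ⟨1, by norm_num, e1⟩

/-- The first point of a closed set met along a segment. -/
theorem IsRTree.exists_first (hT : IsRTree T) {C : Set T} (hC : IsClosed C) {p y : T}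
    (hy : y ∈ C) : ∃ q ∈ C, q ∈ treeSeg p y ∧ ∀ x ∈ treeSeg p q, x ∈ C → x = q := by
  obtain ⟨f, hc, rfl, rfl, -, h⟩ := hT.exists_param p y
  have hK : IsCompact (Icc (0 : ℝ) 1 ∩ f ⁻¹' C) :=
    isCompact_Icc.of_isClosed_subset (hc.preimage_isClosed_of_isClosed isClosed_Icc hC)
      inter_subset_left
  obtain ⟨t, ⟨ht, htC⟩, hmin⟩ := hK.exists_isLeast ⟨1, by simp, hy⟩
  refine ⟨f t, htC, ?_, ?_⟩
  · rw [← h 0 1 le_rfl zero_le_one le_rfl]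
    exact ⟨t, ht, rfl⟩
  · rw [← h 0 t le_rfl ht.1 ht.2]
    rintro _ ⟨s, hs, rfl⟩ hsC
    rw [le_antisymm hs.2 (hmin ⟨⟨hs.1, hs.2.trans ht.2⟩, hsC⟩)]

theorem IsRTree.exists_median [T2Space T] (hT : IsRTree T) (a b c : T) :
    ∃ m, m ∈ treeSeg a b ∧ m ∈ treeSeg b c ∧ m ∈ treeSeg a c := by
  obtain ⟨m, hm, hab, hfirst⟩ := hT.exists_first (hT.isCompact_treeSeg b c).isClosed (p := a)
    (hT.left_mem b c)
  exact ⟨m, hab, hm,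
    hT.mem_of_inter_subset fun x hx hxc => hfirst x hx (hT.treeSeg_subset_right hm hxc)⟩

/-- A monotone sequence in a segment converges. -/
theorem IsRTree.exists_tendsto (hT : IsRTree T) {p b : T} {x : ℕ → T}
    (hx : ∀ n, x n ∈ treeSeg p b) (hmono : ∀ n, x n ∈ treeSeg p (x (n + 1))) :
    ∃ y, Filter.Tendsto x Filter.atTop (nhds y) := by
  by_cases hpb : p = b
  · subst hpb
    refine ⟨p, ?_⟩
    have : x = fun _ => p := funext fun n => by simpa [treeSeg_self] using hx n
    rw [this]
    exact tendsto_const_nhds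
  obtain ⟨f, hc, rfl, rfl, hi, h⟩ := hT.exists_param p b
  have hx' : ∀ n, ∃ s ∈ Icc (0 : ℝ) 1, f s = x n := by
    intro n
    have := hx n
    rwa [← h 0 1 le_rfl zero_le_one le_rfl] at this
  choose s hs hsx using hx'
  have hsm : Monotone s := by
    refine monotone_nat_of_le_succ fun n => ?_
    have := hmono n
    rw [← hsx (n + 1), ← h 0 _ le_rfl (hs (n + 1)).1 (hs (n + 1)).2, ← hsx n] at this
    obtain ⟨u, hu, hue⟩ := this
    rw [← hi hpb ⟨hu.1, hu.2.trans (hs (n + 1)).2⟩ (hs n) hue]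
    exact hu.2
  have hlim := tendsto_atTop_ciSup hsm ⟨1, by rintro _ ⟨n, rfl⟩; exact (hs n).2⟩
  have hmem : (⨆ n, s n) ∈ Icc (0 : ℝ) 1 :=
    isClosed_Icc.mem_of_tendsto hlim (Filter.Eventually.of_forall hs)
  refine ⟨f (⨆ n, s n), ?_⟩
  have := (hc _ hmem).tendsto.comp
    (tendsto_nhdsWithin_iff.2 ⟨hlim, Filter.Eventually.of_forall hs⟩)
  exact this.congr hsx

end Segments

section Actions

variable {T G : Type*} [TopologicalSpace T] [Group G] [MulAction G T]

theorem smul_treeSeg_subset (hcont : ∀ g : G, Continuous fun x : T => g • x) (g : G) (a b : T) :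
    (fun x => g • x) '' treeSeg a b ⊆ treeSeg (g • a) (g • b) := by
  rintro _ ⟨x, ⟨rfl, rfl⟩ | ⟨A, ⟨f, hc, hi, rfl, rfl, rfl⟩, hx⟩, rfl⟩
  · exact Or.inl ⟨rfl, rfl⟩
  · refine Or.inr ⟨(fun x => g • x) '' (f '' Icc 0 1), ⟨fun t => g • f t, ?_, ?_, rfl, rfl, ?_⟩,
      x, hx, rfl⟩
    · exact (hcont g).comp_continuousOn hc
    · exact fun s hs t ht h => hi hs ht (MulAction.injective g h)
    · rw [image_image]

theorem smul_mem_treeSeg (hcont : ∀ g : G, Continuous fun x : T => g • x) (g : G) {a b x : T}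
    (hx : x ∈ treeSeg a b) : g • x ∈ treeSeg (g • a) (g • b) :=
  smul_treeSeg_subset hcont g a b ⟨x, hx, rfl⟩

theorem smul_treeSeg (hcont : ∀ g : G, Continuous fun x : T => g • x) (g : G) (a b : T) :
    (fun x => g • x) '' treeSeg a b = treeSeg (g • a) (g • b) := by
  refine Subset.antisymm (smul_treeSeg_subset hcont g a b) fun x hx => ⟨g⁻¹ • x, ?_, by simp⟩
  simpa using smul_mem_treeSeg hcont g⁻¹ hx

theorem NonNesting.treeSeg_subset (hnn : NonNesting G T) (hT : IsRTree T)
    (hcont : ∀ g : G, Continuous fun x : T => g • x) {g : G} {a b : T}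
    (h : treeSeg (g • a) (g • b) ⊆ treeSeg a b) : treeSeg a b ⊆ treeSeg (g • a) (g • b) := by
  by_cases hab : a = b
  · subst hab
    simpa [treeSeg_self, eq_comm] using h
  obtain ⟨A, hA⟩ := (hT a b hab).1
  by_contra hcon
  apply hnn g a b A hA
  rw [← hT.treeSeg_eq hA, smul_treeSeg hcont]
  exact ⟨h, hcon⟩

theorem NonNesting.smul_eq_of_smul_mem (hnn : NonNesting G T) (hT : IsRTree T)
    (hcont : ∀ g : G, Continuous fun x : T => g • x) {g : G} {a x : T} (ha : g • a = a)
    (h : g • x ∈ treeSeg a x) : g • x = x := by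
  have hsub : treeSeg (g • a) (g • x) ⊆ treeSeg a x := by
    rw [ha]
    exact hT.treeSeg_subset_left h
  have := hnn.treeSeg_subset hT hcont hsub (hT.right_mem a x)
  rw [ha] at this
  exact hT.eq_of_mem_of_mem h this

theorem NonNesting.smul_eq_of_mem_smul (hnn : NonNesting G T) (hT : IsRTree T)
    (hcont : ∀ g : G, Continuous fun x : T => g • x) {g : G} {a x : T} (ha : g • a = a)
    (h : x ∈ treeSeg a (g • x)) : g • x = x := by
  have := hnn.smul_eq_of_smul_mem hT hcont (g := g⁻¹) (a := a) (x := g • x)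
    (by rw [inv_smul_eq_iff, ha]) (by simpa using h)
  simpa using this.symm

theorem NonNesting.smul_eq_of_comparable (hnn : NonNesting G T) (hT : IsRTree T)
    (hcont : ∀ g : G, Continuous fun x : T => g • x) {g : G} {a b x : T} (ha : g • a = a)
    (hx : x ∈ treeSeg a b) (hgx : g • x ∈ treeSeg a b) : g • x = x := by
  rcases hT.total hx hgx with h | h
  · exact hnn.smul_eq_of_mem_smul hT hcont ha h
  · exact hnn.smul_eq_of_smul_mem hT hcont ha h

theorem NonNesting.smul_eq_of_mem_treeSeg (hnn : NonNesting G T) (hT : IsRTree T)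
    (hcont : ∀ g : G, Continuous fun x : T => g • x) {g : G} {a b x : T} (ha : g • a = a)
    (hb : g • b = b) (hx : x ∈ treeSeg a b) : g • x = x := by
  refine hnn.smul_eq_of_comparable hT hcont ha hx ?_
  simpa [ha, hb] using smul_mem_treeSeg hcont g hx

theorem NonNesting.exists_fixed_mem_treeSeg_smul [T2Space T] (hnn : NonNesting G T)
    (hT : IsRTree T) (hcont : ∀ g : G, Continuous fun x : T => g • x) {g : G}
    (hg : ∃ a : T, g • a = a) (c : T) : ∃ m ∈ treeSeg c (g • c), g • m = m := by
  obtain ⟨b, hb⟩ := hg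
  obtain ⟨m, hm, hmc, hmb⟩ := hT.exists_median b c (g • c)
  refine ⟨m, hmc, hnn.smul_eq_of_comparable hT hcont hb hmb ?_⟩
  simpa [hb] using smul_mem_treeSeg hcont g hm

theorem NonNesting.eq_of_mem_of_smul_eq (hnn : NonNesting G T) (hT : IsRTree T)
    (hcont : ∀ g : G, Continuous fun x : T => g • x) {u v : G} {c d m n : T} (huc : u • c = d)
    (hvc : v • c = d) (hum : u • m = m) (hvn : v • n = n) (hn : n ∈ treeSeg c d)
    (hmn : m ∈ treeSeg c n) : m = n := by
  have hnd : n ∈ treeSeg d m := by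
    rw [treeSeg_comm]
    exact hT.mem_of_mem_of_mem hmn hn
  have hsub : treeSeg ((u⁻¹ * v) • c) ((u⁻¹ * v) • n) ⊆ treeSeg c m := by
    rw [mul_smul, mul_smul, hvc, hvn, inv_smul_eq_iff.2 huc.symm]
    refine hT.treeSeg_subset_left ?_
    have h := smul_mem_treeSeg hcont u⁻¹ hnd
    rwa [inv_smul_eq_iff.2 hum.symm, inv_smul_eq_iff.2 huc.symm] at h
  have := hnn.treeSeg_subset hT hcont (hsub.trans (hT.treeSeg_subset_left hmn))
    (hT.right_mem c n)
  exact hT.eq_of_mem_of_mem hmn (hsub this)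

/-- If all elements are elliptic, any two of them have a common fixed point. -/
theorem NonNesting.exists_common_fixed [T2Space T] (hnn : NonNesting G T) (hT : IsRTree T)
    (hcont : ∀ g : G, Continuous fun x : T => g • x) (hell : ∀ g : G, ∃ x : T, g • x = x)
    (g h : G) : ∃ x : T, g • x = x ∧ h • x = x := by
  obtain ⟨c, hc⟩ := hell (g * h)
  have hd : h • c = g⁻¹ • c := by
    rw [eq_inv_smul_iff, ← mul_smul, hc]
  obtain ⟨m, hm, hhm⟩ := hnn.exists_fixed_mem_treeSeg_smul hT hcont (hell h) c
  obtain ⟨n, hn, hgn⟩ := hnn.exists_fixed_mem_treeSeg_smul hT hcont (hell g⁻¹) c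
  have hmn : m = n := by
    rcases hT.total hm (hd ▸ hn) with hmn | hnm
    · exact hnn.eq_of_mem_of_smul_eq hT hcont hd rfl hhm hgn hn hmn
    · exact (hnn.eq_of_mem_of_smul_eq hT hcont hd.symm rfl hgn hhm hm hnm).symm
  subst hmn
  exact ⟨m, (inv_smul_eq_iff.1 hgn).symm, hhm⟩

/-- The projection of a point to the fixed point set of an elliptic element. -/
theorem NonNesting.exists_projection [T2Space T] (hnn : NonNesting G T) (hT : IsRTree T)
    (hcont : ∀ g : G, Continuous fun x : T => g • x) {g : G} (hg : ∃ x : T, g • x = x) (p : T) :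
    ∃ q : T, g • q = q ∧ ∀ y : T, g • y = y → q ∈ treeSeg p y := by
  obtain ⟨y₀, hy₀⟩ := hg
  obtain ⟨q, hq, -, hfirst⟩ := hT.exists_first (C := {x : T | g • x = x})
    (isClosed_eq (hcont g) continuous_id) (p := p) hy₀
  refine ⟨q, hq, fun y hy => ?_⟩
  obtain ⟨m, hpq, hqy, hpy⟩ := hT.exists_median p q y
  rwa [← hfirst m hpq (hnn.smul_eq_of_mem_treeSeg hT hcont hq hy hqy)]

end Actions

section Rays

variable {T : Type*} [TopologicalSpace T]

theorem IsRTree.exists_ray_param (hT : IsRTree T) {p : T} {x : ℕ → T}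
    (hmono : ∀ n, x n ∈ treeSeg p (x (n + 1))) (hne : ∀ n, x n ≠ x (n + 1)) :
    ∃ φ : ℝ → T, ContinuousOn φ (Ici 0) ∧ InjOn φ (Ici 0) ∧ ∀ n : ℕ, φ n = x n := by
  choose f hfc hf0 hf1 hfi hf using fun n => hT.exists_param (x n) (x (n + 1))
  let φ : ℝ → T := fun t => f ⌊t⌋₊ (t - ⌊t⌋₊)
  have hle : ∀ m n, m ≤ n → x m ∈ treeSeg p (x n) := by
    intro m n hmn
    induction n, hmn using Nat.le_induction with
    | base => exact hT.right_mem _ _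
    | succ n _ ih => exact hT.treeSeg_subset_left (hmono n) ih
  have hφn : ∀ n : ℕ, φ n = x n := fun n => by simp [φ, hf0]
  have hφ : ∀ n : ℕ, EqOn φ (fun t => f n (t - n)) (Icc n (n + 1)) := by
    intro n t ht
    rcases ht.2.eq_or_lt with h | h
    · have h1 : φ t = x (n + 1) := by
        rw [h]
        exact_mod_cast hφn (n + 1)
      rw [h1, h]
      simp [hf1]
    · have : ⌊t⌋₊ = n := (Nat.floor_eq_iff (n.cast_nonneg.trans ht.1)).2 ⟨ht.1, h⟩
      simp [φ, this]
  have hmap : ∀ n : ℕ, MapsTo (fun t : ℝ => t - n) (Icc n (n + 1)) (Icc 0 1) := by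
    intro n t ht
    constructor <;> linarith [ht.1, ht.2]
  have hcIcc : ∀ n : ℕ, ContinuousOn φ (Icc 0 n) := by
    intro n
    induction n with
    | zero => simp
    | succ n ih =>
      push_cast
      rw [← Icc_union_Icc_eq_Icc (n.cast_nonneg (α := ℝ)) (by linarith : (n : ℝ) ≤ n + 1)]
      refine ih.union_of_isClosed ?_ isClosed_Icc isClosed_Icc
      exact ((hfc n).comp (by fun_prop) (hmap n)).congr (hφ n)
  have hfloor : ∀ t : ℝ, 0 ≤ t → t ∈ Icc (⌊t⌋₊ : ℝ) (⌊t⌋₊ + 1) := fun t ht =>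
    ⟨Nat.floor_le ht, (Nat.lt_floor_add_one t).le⟩
  have hbetween : ∀ t : ℝ, 0 ≤ t → φ t ∈ treeSeg (x ⌊t⌋₊) (x (⌊t⌋₊ + 1)) := by
    intro t ht
    have := hf ⌊t⌋₊ 0 1 le_rfl zero_le_one le_rfl
    rw [hf0, hf1] at this
    rw [← this]
    exact ⟨_, hmap _ (hfloor t ht), rfl⟩
  have hinj : ∀ t u : ℝ, 0 ≤ t → t < u → φ t ≠ φ u := by
    intro t u ht htu heq
    have hu : 0 ≤ u := ht.trans htu.le
    rcases (Nat.floor_mono htu.le).eq_or_lt with h | h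
    · have heq' : f ⌊t⌋₊ (t - ⌊t⌋₊) = f ⌊u⌋₊ (u - ⌊u⌋₊) := heq
      rw [← h] at heq'
      have := hfi _ (hne _) (hmap _ (hfloor t ht)) (hmap _ (h ▸ hfloor u hu)) heq'
      linarith
    · have h1 : φ t ∈ treeSeg p (x (⌊t⌋₊ + 1)) := (hT.between (hmono _) (hbetween t ht)).2
      have h2 : x (⌊t⌋₊ + 1) ∈ treeSeg p (φ t) := by
        rw [heq]
        exact hT.treeSeg_subset_left (hT.between (hmono _) (hbetween u hu)).1 (hle _ _ h)
      have h3 : φ t = x (⌊t⌋₊ + 1) := hT.eq_of_mem_of_mem h1 h2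
      have := hfi _ (hne _) (hmap _ (hfloor t ht)) (by simp) (h3.trans (hf1 _).symm)
      linarith [Nat.lt_floor_add_one t]
  refine ⟨φ, ?_, ?_, hφn⟩
  · intro t ht
    have h := hcIcc (⌊t⌋₊ + 1) t ⟨ht, by exact_mod_cast (Nat.lt_floor_add_one t).le⟩
    refine h.mono_of_mem_nhdsWithin ?_
    rw [← Ici_inter_Iic]
    refine Filter.inter_mem self_mem_nhdsWithin (mem_nhdsWithin_of_mem_nhds (Iic_mem_nhds ?_))
    exact_mod_cast Nat.lt_floor_add_one t
  · intro t ht u hu htu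
    rcases lt_trichotomy t u with h | h | h
    · exact absurd htu (hinj t u ht h)
    · exact h
    · exact absurd htu.symm (hinj u t hu h)

/-- An injective path on a half-line that accumulates nowhere at infinity is a closed
embedding, so its image is a closed ray. -/
theorem isClosed_and_isRay_image_Ici [T2Space T] {φ : ℝ → T} {s : ℝ}
    (hc : ContinuousOn φ (Ici s)) (hi : InjOn φ (Ici s))
    (hlim : ∀ (U : Ultrafilter ℝ) (y : T), (U : Filter ℝ) ≤ Filter.atTop →
      ¬Filter.Tendsto φ U (nhds y)) :
    IsClosed (φ '' Ici s) ∧ IsRay (φ '' Ici s) := by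
  have hce : Topology.IsClosedEmbedding ((Ici s).domRestrict φ) := by
    refine .of_continuous_injective_isClosedMap hc.domRestrict (injOn_iff_injective.1 hi)
      (IsProperMap.isClosedMap ?_)
    refine isProperMap_iff_ultrafilter_of_t2.2 ⟨hc.domRestrict, fun U y hU => ?_⟩
    by_cases hcpt : ∃ M : ℝ, {t : Ici s | (t : ℝ) ≤ M} ∈ U
    · obtain ⟨M, hM⟩ := hcpt
      have hK : IsCompact {t : Ici s | (t : ℝ) ≤ M} := by
        rw [Subtype.isCompact_iff]
        convert isCompact_Icc (a := s) (b := M) using 1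
        ext t
        simp [and_comm]
      obtain ⟨t, -, ht⟩ := hK.ultrafilter_le_nhds U (Filter.le_principal_iff.2 hM)
      exact ⟨t, ht⟩
    · push Not at hcpt
      exfalso
      refine hlim (U.map Subtype.val) y ?_ ?_
      · refine Filter.le_def.2 fun A hA => ?_
        obtain ⟨M, hM⟩ := Filter.mem_atTop_sets.1 hA
        have hU' : {t : Ici s | (t : ℝ) ≤ M}ᶜ ∈ U := Ultrafilter.compl_mem_iff_notMem.2 (hcpt M)
        exact Filter.mem_of_superset hU' fun t ht => hM _ (not_le.1 ht).le
      · exact hU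
  have hrange : range ((Ici s).domRestrict φ) = φ '' Ici s := range_domRestrict φ (Ici s)
  refine ⟨hrange ▸ hce.isClosed_range, ?_⟩
  have e : ↥(Ici s) ≃ₜ ↥(Ici (0 : ℝ)) :=
    { toFun := fun t => ⟨t - s, sub_nonneg.2 (mem_Ici.1 t.2)⟩
      invFun := fun t => ⟨t + s, le_add_of_nonneg_left (mem_Ici.1 t.2)⟩
      left_inv := fun t => by simp
      right_inv := fun t => by simp
      continuous_toFun := (continuous_subtype_val.sub continuous_const).subtype_mk _
      continuous_invFun := (continuous_subtype_val.add continuous_const).subtype_mk _ }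
  exact ⟨((Homeomorph.setCongr hrange.symm).trans hce.isEmbedding.toHomeomorph.symm).trans e⟩

end Rays

/-- A chain without largest element in a metric tree has a strictly increasing cofinal
sequence. -/
theorem IsRTree.exists_cofinal_seq {T ι : Type*} [MetricSpace T] [Nonempty ι] (hT : IsRTree T)
    {p : T} {q : ι → T} (htot : ∀ i j, q i ∈ treeSeg p (q j) ∨ q j ∈ treeSeg p (q i))
    (hmax : ∀ i, ∃ j, q j ∉ treeSeg p (q i)) :
    ∃ k : ℕ → ι, (∀ n, q (k n) ∈ treeSeg p (q (k (n + 1)))) ∧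
      (∀ n, q (k n) ≠ q (k (n + 1))) ∧ ∀ i, ∃ n, q i ∈ treeSeg p (q (k n)) := by
  obtain ⟨i₀⟩ := ‹Nonempty ι›
  have htrans : ∀ {x y z : T}, x ∈ treeSeg p y → y ∈ treeSeg p z → x ∈ treeSeg p z :=
    fun hxy hyz => hT.treeSeg_subset_left hyz hxy
  by_cases hb : ∀ s : ℕ → ι, ∃ b, ∀ n, q (s n) ∈ treeSeg p (q b)
  · exfalso
    have hsmall : ∀ ε : ℝ, 0 < ε → ∃ i, ∀ j, q i ∈ treeSeg p (q j) → dist (q i) (q j) ≤ ε := by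
      intro ε hε
      by_contra! hcon
      choose F hF hFd using hcon
      obtain ⟨b, hb⟩ := hb fun n => F^[n] i₀
      have hstep : ∀ n, F^[n + 1] i₀ = F (F^[n] i₀) := fun n =>
        Function.iterate_succ_apply' F n i₀
      obtain ⟨y, hy⟩ := hT.exists_tendsto (x := fun n => q (F^[n] i₀)) hb
        fun n => by rw [hstep]; exact hF _
      have hd := hy.dist (hy.comp (Filter.tendsto_add_atTop_nat 1))
      rw [dist_self] at hd
      obtain ⟨n, hn⟩ := (hd.eventually (gt_mem_nhds hε)).exists
      simp only [Function.comp_apply, hstep] at hn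
      exact (hFd _).not_gt hn
    choose i hi using fun n : ℕ => hsmall (1 / ((n : ℝ) + 1)) Nat.one_div_pos_of_nat
    obtain ⟨b, hb⟩ := hb i
    obtain ⟨j, hj⟩ := hmax b
    have hbj := (htot b j).resolve_right hj
    have hle : ∀ n : ℕ, dist (q b) (q j) ≤ 1 / ((n : ℝ) + 1) + 1 / ((n : ℝ) + 1) := fun n =>
      (dist_triangle_left _ _ (q (i n))).trans
        (add_le_add (hi n b (hb n)) (hi n j (htrans (hb n) hbj)))
    have hlim := (tendsto_one_div_add_atTop_nhds_zero_nat (𝕜 := ℝ)).add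
      (tendsto_one_div_add_atTop_nhds_zero_nat (𝕜 := ℝ))
    have h0 : dist (q b) (q j) ≤ 0 + 0 := ge_of_tendsto' hlim hle
    have : q b = q j := dist_le_zero.1 (by simpa using h0)
    exact hj (this ▸ hT.right_mem _ _)
  · push Not at hb
    obtain ⟨s, hs⟩ := hb
    have hstep : ∀ (n : ℕ) (i : ι), ∃ j, q i ∈ treeSeg p (q j) ∧ q i ≠ q j ∧
        q (s n) ∈ treeSeg p (q j) := by
      intro n i
      obtain ⟨j, hj⟩ := hmax i
      have hij := (htot i j).resolve_right hj
      rcases htot j (s n) with h | h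
      · exact ⟨s n, htrans hij h, fun he => hj (he ▸ h), hT.right_mem _ _⟩
      · exact ⟨j, hij, fun he => hj (he ▸ hT.right_mem _ _), h⟩
    choose F hF1 hF2 hF3 using hstep
    let k : ℕ → ι := fun n => Nat.rec i₀ F n
    refine ⟨k, fun n => hF1 n (k n), fun n => hF2 n (k n), fun i => ?_⟩
    obtain ⟨n, hn⟩ := hs i
    exact ⟨n + 1, htrans ((htot i (s n)).resolve_right hn) (hF3 n (k n))⟩

theorem stmt18 {T G : Type*} [MetricSpace T] [Group G] [MulAction G T]
    (hRT : IsRTree T) (hcont : ∀ g : G, Continuous fun x : T => g • x)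
    (hnn : NonNesting G T) (hell : ∀ g : G, ∃ x : T, g • x = x) :
    (∃ x : T, ∀ g : G, g • x = x) ∨
    (∃ R : Set T, IsRay R ∧ ∀ g : G, IsRay (((fun x => g • x) '' R) ∩ R)) := by
  by_cases hfp : ∃ x : T, ∀ g : G, g • x = x
  · exact Or.inl hfp
  right
  obtain ⟨p, -⟩ := hell 1
  choose q hq hproj using fun g : G => hnn.exists_projection hRT hcont (hell g) p
  have htot : ∀ g h, q g ∈ treeSeg p (q h) ∨ q h ∈ treeSeg p (q g) := by
    intro g h
    obtain ⟨y, hgy, hhy⟩ := hnn.exists_common_fixed hRT hcont hell g h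
    exact hRT.total (hproj g y hgy) (hproj h y hhy)
  have hfix : ∀ g h, q g ∈ treeSeg p (q h) → g • q h = q h := by
    intro g h hgh
    obtain ⟨y, hgy, hhy⟩ := hnn.exists_common_fixed hRT hcont hell g h
    exact hnn.smul_eq_of_mem_treeSeg hRT hcont (hq g) hgy
      (hRT.mem_of_mem_of_mem hgh (hproj h y hhy))
  have hmax : ∀ g, ∃ h, q h ∉ treeSeg p (q g) := by
    by_contra! hcon
    obtain ⟨g, hg⟩ := hcon
    exact hfp ⟨q g, fun h => hfix h g (hg h)⟩
  obtain ⟨k, hmono, hne, hcof⟩ := hRT.exists_cofinal_seq htot hmax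
  obtain ⟨φ, hφc, hφi, hφx⟩ := hRT.exists_ray_param hmono hne
  have hseg : ∀ {s t : ℝ}, 0 ≤ s → s ≤ t → φ '' Icc s t = treeSeg (φ s) (φ t) := by
    intro s t hs hst
    have hsub : Icc s t ⊆ Ici 0 := fun _ hu => hs.trans hu.1
    exact hRT.image_Icc_eq hst (hφc.mono hsub) (hφi.mono hsub)
  have htail : ∀ g : G, ∃ N : ℕ, ∀ t : ℝ, N ≤ t → g • φ t = φ t := by
    intro g
    obtain ⟨N, hN⟩ := hcof g
    have hx : ∀ n, N ≤ n → q g ∈ treeSeg p (q (k n)) := by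
      intro n hn
      induction n, hn using Nat.le_induction with
      | base => exact hN
      | succ n _ ih => exact hRT.treeSeg_subset_left (hmono n) ih
    refine ⟨N, fun t ht => ?_⟩
    have htM := Nat.le_ceil t
    have hNM : N ≤ ⌈t⌉₊ := by exact_mod_cast ht.trans htM
    have hmem : φ t ∈ treeSeg (φ N) (φ ⌈t⌉₊) := by
      rw [← hseg N.cast_nonneg (ht.trans htM)]
      exact ⟨t, ⟨ht, htM⟩, rfl⟩
    rw [hφx, hφx] at hmem
    exact hnn.smul_eq_of_mem_treeSeg hRT hcont (hfix _ _ hN) (hfix _ _ (hx _ hNM)) hmem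
  have hlim : ∀ (U : Ultrafilter ℝ) (y : T), (U : Filter ℝ) ≤ Filter.atTop →
      ¬Filter.Tendsto φ U (nhds y) := by
    intro U y hU hy
    refine hfp ⟨y, fun g => ?_⟩
    obtain ⟨N, hN⟩ := htail g
    refine tendsto_nhds_unique (((hcont g).tendsto y).comp hy) (hy.congr' ?_)
    filter_upwards [hU (Filter.eventually_ge_atTop (N : ℝ))] with t ht
    exact (hN t ht).symm
  have hray : ∀ s : ℝ, 0 ≤ s → IsClosed (φ '' Ici s) ∧ IsRay (φ '' Ici s) := fun s hs =>
    isClosed_and_isRay_image_Ici (hφc.mono (Ici_subset_Ici.2 hs))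
      (hφi.mono (Ici_subset_Ici.2 hs)) hlim
  refine ⟨φ '' Ici 0, (hray 0 le_rfl).2, fun g => ?_⟩
  obtain ⟨N, hN⟩ := htail g⁻¹
  let S : Set ℝ := Ici 0 ∩ φ ⁻¹' ((fun x => g⁻¹ • x) ⁻¹' (φ '' Ici 0))
  have hSc : IsClosed S := hφc.preimage_isClosed_of_isClosed isClosed_Ici
    ((hray 0 le_rfl).1.preimage (hcont g⁻¹))
  have hSne : S.Nonempty := ⟨N, mem_Ici.2 N.cast_nonneg, N, mem_Ici.2 N.cast_nonneg, (hN N le_rfl).symm⟩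
  have hSb : BddBelow S := ⟨0, fun t ht => ht.1⟩
  obtain ⟨hs0, a, ha, has⟩ : sInf S ∈ S := hSc.csInf_mem hSne hSb
  have hinter : (fun x => g • x) '' (φ '' Ici 0) ∩ φ '' Ici 0 = φ '' Ici (sInf S) := by
    ext x
    constructor
    · rintro ⟨⟨y, hy, rfl⟩, t, ht, htx⟩
      refine ⟨t, csInf_le hSb ⟨ht, ?_⟩, htx⟩
      change g⁻¹ • φ t ∈ φ '' Ici 0
      rw [htx]
      simpa using hy
    · rintro ⟨t, ht, rfl⟩
      refine ⟨⟨g⁻¹ • φ t, ?_, by simp⟩, t, mem_Ici.2 (le_trans hs0 ht), rfl⟩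
      let M : ℝ := max (N : ℝ) (max t a)
      have htM : t ≤ M := (le_max_left t a).trans (le_max_right _ _)
      have haM : a ≤ M := (le_max_right t a).trans (le_max_right _ _)
      have hmem : φ t ∈ treeSeg (φ (sInf S)) (φ M) := by
        rw [← hseg hs0 (le_trans ht htM)]
        exact ⟨t, ⟨ht, htM⟩, rfl⟩
      have hmem' := smul_mem_treeSeg hcont g⁻¹ hmem
      rw [hN M (le_max_left _ _), ← show φ a = g⁻¹ • φ (sInf S) from has, ← hseg ha haM] at hmem'
      exact image_mono (fun u hu => le_trans ha hu.1) hmem'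
  rw [hinter]
  exact (hray _ hs0).2
end
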